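/- Let X be a normal locally noetherian scheme that is locally of finite type over a quotient R₀/I of a regular commutative ring R₀. Let U be an open subscheme of X whose complement Z = X ∖ U has everywhere codimension at least 2 in X, and let i : U → X be the inclusion. If F is a reflexive coherent sheaf of O_U-modules, then i_*F is a reflexive coherent sheaf of O_X-modules. -/

import Mathlib

set_option linter.unusedVariables false
open CategoryTheory TopologicalSpace Opposite
universe u
variable {α : Type u} [TopologicalSpace α]

lemma map_map_apply (O : (Opens α)ᵒᵖ ⥤ CommRingCat.{u}) {A B C : Opens α}
    (h₁ : B ≤ A) (h₂ : C ≤ B) (r : O.obj (op A)) :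
    O.map (homOfLE h₂).op (O.map (homOfLE h₁).op r) = O.map (homOfLE (h₂.trans h₁)).op r := by
  rw [← comp_apply, ← O.map_comp]; rfl

lemma map_id_apply (O : (Opens α)ᵒᵖ ⥤ CommRingCat.{u}) {A : Opens α} (h : A ≤ A)
    (r : O.obj (op A)) : O.map (homOfLE h).op r = r := by
  rw [show (homOfLE h).op = 𝟙 (op A) from rfl, O.map_id]; rfl

structure OModuleOn (O : (Opens α)ᵒᵖ ⥤ CommRingCat.{u}) (U : Opens α) : Type (u + 1) where
  sec : ∀ (W : Opens α), W ≤ U → Type u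
  [secAddCommGroup : ∀ W hW, AddCommGroup (sec W hW)]
  [secModule : ∀ W hW, Module (O.obj (op W)) (sec W hW)]
  res : ∀ {W W' : Opens α} (hW : W ≤ U) (h : W' ≤ W), sec W hW → sec W' (h.trans hW)
  res_add : ∀ {W W'} (hW : W ≤ U) (h : W' ≤ W) (s t : sec W hW),
    res hW h (s + t) = res hW h s + res hW h t
  res_smul : ∀ {W W'} (hW : W ≤ U) (h : W' ≤ W) (r : O.obj (op W)) (s : sec W hW),
    res hW h (r • s) = O.map (homOfLE h).op r • res hW h s
  res_id : ∀ (W) (hW : W ≤ U) (s : sec W hW), res hW le_rfl s = s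
  res_comp : ∀ {W W' W''} (hW : W ≤ U) (h : W' ≤ W) (h' : W'' ≤ W') (s : sec W hW),
    res (h.trans hW) h' (res hW h s) = res hW (h'.trans h) s

attribute [instance] OModuleOn.secAddCommGroup OModuleOn.secModule

namespace OModuleOn
variable {O : (Opens α)ᵒᵖ ⥤ CommRingCat.{u}} {U : Opens α}

def resAddHom (F : OModuleOn O U) {W W' : Opens α} (hW : W ≤ U) (h : W' ≤ W) :
    F.sec W hW →+ F.sec W' (h.trans hW) :=
  AddMonoidHom.mk' (F.res hW h) (F.res_add hW h)

lemma res_zero (F : OModuleOn O U) {W W' : Opens α} (hW : W ≤ U) (h : W' ≤ W) :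
    F.res hW h (0 : F.sec W hW) = 0 := (F.resAddHom hW h).map_zero

lemma res_neg (F : OModuleOn O U) {W W' : Opens α} (hW : W ≤ U) (h : W' ≤ W) (s : F.sec W hW) :
    F.res hW h (-s) = -F.res hW h s := (F.resAddHom hW h).map_neg s

end OModuleOn

@[ext]
structure OModuleHom {O : (Opens α)ᵒᵖ ⥤ CommRingCat.{u}} {U : Opens α}
    (F G : OModuleOn O U) : Type u where
  app : ∀ (W : Opens α) (hW : W ≤ U), F.sec W hW → G.sec W hW
  app_add : ∀ W hW (s t : F.sec W hW), app W hW (s + t) = app W hW s + app W hW t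
  app_smul : ∀ W hW (r : O.obj (op W)) (s : F.sec W hW), app W hW (r • s) = r • app W hW s
  naturality : ∀ {W W'} (hW : W ≤ U) (h : W' ≤ W) (s : F.sec W hW),
    app W' (h.trans hW) (F.res hW h s) = G.res hW h (app W hW s)

namespace OModuleHom
variable {O : (Opens α)ᵒᵖ ⥤ CommRingCat.{u}} {U : Opens α} {F G : OModuleOn O U}

def IsIso (φ : OModuleHom F G) : Prop := ∀ W hW, Function.Bijective (φ.app W hW)

def appAddHom (φ : OModuleHom F G) (W : Opens α) (hW : W ≤ U) :
    F.sec W hW →+ G.sec W hW :=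
  AddMonoidHom.mk' (φ.app W hW) (φ.app_add W hW)

lemma app_zero (φ : OModuleHom F G) (W hW) : φ.app W hW 0 = 0 := (φ.appAddHom W hW).map_zero

lemma app_neg (φ : OModuleHom F G) (W hW) (s : F.sec W hW) :
    φ.app W hW (-s) = -φ.app W hW s := (φ.appAddHom W hW).map_neg s

instance : Zero (OModuleHom F G) :=
  ⟨{ app := fun W hW s => 0
     app_add := by intros; simp
     app_smul := by intros; simp
     naturality := by intros W W' hW h s; simp [G.res_zero] }⟩

instance : Add (OModuleHom F G) :=
  ⟨fun φ ψ =>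
    { app := fun W hW s => φ.app W hW s + ψ.app W hW s
      app_add := by intros W hW s t; rw [φ.app_add, ψ.app_add]; abel
      app_smul := by intros W hW r s; rw [φ.app_smul, ψ.app_smul, smul_add]
      naturality := by
        intros W W' hW h s
        rw [φ.naturality, ψ.naturality, G.res_add] }⟩

instance : Neg (OModuleHom F G) :=
  ⟨fun φ =>
    { app := fun W hW s => -φ.app W hW s
      app_add := by intros W hW s t; rw [φ.app_add]; abel
      app_smul := by intros W hW r s; rw [φ.app_smul, smul_neg]
      naturality := by
        intros W W' hW h s
        rw [φ.naturality, G.res_neg] }⟩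

@[simp] lemma zero_app (W hW) (s : F.sec W hW) : (0 : OModuleHom F G).app W hW s = 0 := rfl
@[simp] lemma add_app (φ ψ : OModuleHom F G) (W hW) (s : F.sec W hW) :
    (φ + ψ).app W hW s = φ.app W hW s + ψ.app W hW s := rfl
@[simp] lemma neg_app (φ : OModuleHom F G) (W hW) (s : F.sec W hW) :
    (-φ).app W hW s = -φ.app W hW s := rfl

instance : AddCommGroup (OModuleHom F G) := by
  refine
  { zero := 0, add := (· + ·), neg := Neg.neg
    add_assoc := ?_, zero_add := ?_, add_zero := ?_, neg_add_cancel := ?_,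
    add_comm := ?_, nsmul := nsmulRec, zsmul := zsmulRec } <;>
  · intros
    ext W hW s
    simp only [add_app, neg_app, zero_app]
    abel

instance : SMul (O.obj (op U)) (OModuleHom F G) :=
  ⟨fun r φ =>
    { app := fun W hW s => O.map (homOfLE hW).op r • φ.app W hW s
      app_add := by intros W hW s t; dsimp only; rw [φ.app_add, smul_add]
      app_smul := by
        intros W hW r' s; dsimp only
        rw [φ.app_smul, smul_smul, smul_smul, mul_comm]
      naturality := by
        intros W W' hW h s; dsimp only
        rw [G.res_smul, φ.naturality, map_map_apply] }⟩

@[simp] lemma smul_app (r : O.obj (op U)) (φ : OModuleHom F G) (W : Opens α) (hW : W ≤ U)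
    (s : F.sec W hW) : (r • φ).app W hW s = O.map (homOfLE hW).op r • φ.app W hW s := rfl

instance : Module (O.obj (op U)) (OModuleHom F G) where
  one_smul φ := by ext W hW s; simp
  mul_smul r r' φ := by ext W hW s; simp [map_mul, mul_smul]
  smul_zero r := by ext W hW s; simp
  smul_add r φ ψ := by ext W hW s; simp [smul_add]
  add_smul r r' φ := by ext W hW s; simp [map_add, add_smul]
  zero_smul φ := by ext W hW s; simp

end OModuleHom

namespace OModuleOn
variable {O : (Opens α)ᵒᵖ ⥤ CommRingCat.{u}} {U : Opens α}

/-- The restriction of a sheaf of modules on `U` to an open subset `V ≤ U`. -/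
def restrictTo (F : OModuleOn O U) {V : Opens α} (hV : V ≤ U) : OModuleOn O V where
  sec W hW := F.sec W (hW.trans hV)
  secAddCommGroup W hW := F.secAddCommGroup W _
  secModule W hW := F.secModule W _
  res hW h := F.res (hW.trans hV) h
  res_add hW h := F.res_add _ _
  res_smul hW h := F.res_smul _ _
  res_id W hW := F.res_id W _
  res_comp hW h h' := F.res_comp _ _ _

/-- The pushforward `i_* F` of a sheaf of modules on `U` along the inclusion `i : U → X`;
its sections over an open `V` are the sections of `F` over `U ⊓ V`. -/
def pushforward (F : OModuleOn O U) : OModuleOn O (⊤ : Opens α) where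
  sec V _ := F.sec (U ⊓ V) inf_le_left
  secAddCommGroup V _ := F.secAddCommGroup _ _
  secModule V _ := Module.compHom _ (O.map (homOfLE (inf_le_right : U ⊓ V ≤ V)).op).hom
  res {V V'} hV h := F.res inf_le_left (inf_le_inf_left U h)
  res_add hV h := F.res_add _ _
  res_smul {V V'} hV h r s := by
    show F.res inf_le_left (inf_le_inf_left U h)
        (O.map (homOfLE (inf_le_right : U ⊓ V ≤ V)).op r • s) = _
    rw [F.res_smul]
    show _ = O.map (homOfLE (inf_le_right : U ⊓ V' ≤ V')).op (O.map (homOfLE h).op r) •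
      F.res inf_le_left (inf_le_inf_left U h) s
    rw [map_map_apply, map_map_apply]
  res_id V hV s := F.res_id _ _ s
  res_comp hV h h' s := F.res_comp _ _ _ s

/-- The structure sheaf `O|_U`, viewed as a sheaf of modules over itself. -/
def unit (O : (Opens α)ᵒᵖ ⥤ CommRingCat.{u}) (U : Opens α) : OModuleOn O U where
  sec W _ := O.obj (op W)
  secAddCommGroup W _ := inferInstance
  secModule W _ := inferInstance
  res hW h s := O.map (homOfLE h).op s
  res_add hW h s t := map_add _ s t
  res_smul hW h r s := by
    dsimp only
    rw [smul_eq_mul, smul_eq_mul, map_mul]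
  res_id W hW s := map_id_apply O _ s
  res_comp hW h h' s := map_map_apply O _ _ s

/-- The sheaf `Hom` of two sheaves of modules on `U`: its sections over `W ≤ U` are the
morphisms `F|_W ⟶ G|_W`. -/
def sheafHom (F G : OModuleOn O U) : OModuleOn O U where
  sec W hW := OModuleHom (F.restrictTo hW) (G.restrictTo hW)
  secAddCommGroup W hW := inferInstance
  secModule W hW := inferInstance
  res {W W'} hW h φ :=
    { app := fun W'' h'' s => φ.app W'' (h''.trans h) s
      app_add := fun W'' h'' => φ.app_add W'' (h''.trans h)
      app_smul := fun W'' h'' => φ.app_smul W'' (h''.trans h)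
      naturality := fun h'' h''' s => φ.naturality (h''.trans h) h''' s }
  res_add hW h φ ψ := by ext W'' h'' s; rfl
  res_smul {W W'} hW h r φ := by
    ext W'' h'' s
    show O.map (homOfLE ((h''.trans h))).op r • φ.app W'' (h''.trans h) s =
      O.map (homOfLE h'').op (O.map (homOfLE h).op r) • φ.app W'' (h''.trans h) s
    rw [map_map_apply]
  res_id W hW φ := by ext W'' h'' s; rfl
  res_comp hW h h' φ := by ext W'' h'' s; rfl

/-- The dual of a sheaf of modules. -/
def dual (F : OModuleOn O U) : OModuleOn O U := sheafHom F (unit O U)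

/-- The bidual of a sheaf of modules. -/
def bidual (F : OModuleOn O U) : OModuleOn O U := dual (dual F)

end OModuleOn

namespace OModuleOn
variable {O : (Opens α)ᵒᵖ ⥤ CommRingCat.{u}} {U : Opens α}

/-- The evaluation of a section of `F` on sections of the dual of `F`. -/
def evalAt (F : OModuleOn O U) (W : Opens α) (hW : W ≤ U) (s : F.sec W hW) :
    OModuleHom ((dual F).restrictTo hW) ((unit O U).restrictTo hW) where
  app W' h' φ := φ.app W' le_rfl (F.res hW h' s)
  app_add W' h' φ ψ := rfl
  app_smul W' h' r φ := by
    show (r • φ).app W' le_rfl (F.res hW h' s) = r • φ.app W' le_rfl (F.res hW h' s)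
    exact congrArg (fun c : O.obj (op W') => c • φ.app W' le_rfl (F.res hW h' s))
      (map_id_apply O le_rfl r)
  naturality {W' W''} h' h'' φ := by
    show φ.app W'' h'' (F.res hW (h''.trans h') s) =
      O.map (homOfLE h'').op (φ.app W' le_rfl (F.res hW h' s))
    rw [← F.res_comp hW h' h'' s]
    exact φ.naturality (le_refl W') h'' (F.res hW h' s)

/-- The canonical morphism from a sheaf of modules to its bidual. -/
def evalHom (F : OModuleOn O U) : OModuleHom F (bidual F) where
  app W hW s := evalAt F W hW s
  app_add W hW s t := by
    apply OModuleHom.ext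
    funext W' h' φ
    show φ.app W' le_rfl (F.res hW h' (s + t)) = _
    rw [F.res_add]
    exact φ.app_add W' le_rfl _ _
  app_smul W hW r s := by
    apply OModuleHom.ext
    funext W' h' φ
    show φ.app W' le_rfl (F.res hW h' (r • s)) = _
    rw [F.res_smul]
    exact φ.app_smul W' le_rfl _ _
  naturality {W W'} hW h s := by
    apply OModuleHom.ext
    funext W'' h'' φ
    show φ.app W'' le_rfl (F.res (h.trans hW) h'' (F.res hW h s)) =
      φ.app W'' le_rfl (F.res hW (h''.trans h) s)
    rw [F.res_comp]

/-- A sheaf of modules is reflexive if the canonical morphism to its bidual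
is an isomorphism. -/
def IsReflexive (F : OModuleOn O U) : Prop := (evalHom F).IsIso

end OModuleOn

namespace OModuleOn
variable {O : (Opens α)ᵒᵖ ⥤ CommRingCat.{u}} {U : Opens α}

/-- The sections `s` generate `F` over `W`: every section of `F` on an open `W' ≤ W` is,
locally around each point, an `O`-linear combination of the restrictions of the `s i`. -/
def Generates (F : OModuleOn O U) {W : Opens α} (hW : W ≤ U) {n : ℕ}
    (s : Fin n → F.sec W hW) : Prop :=
  ∀ (W' : Opens α) (h : W' ≤ W) (t : F.sec W' (h.trans hW)), ∀ x ∈ W',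
    ∃ (W'' : Opens α) (h' : W'' ≤ W'), x ∈ W'' ∧
      ∃ a : Fin n → O.obj (op W''),
        F.res (h.trans hW) h' t = ∑ i, a i • F.res hW (h'.trans h) (s i)

/-- `F` is of finite type: locally generated by finitely many sections. -/
def IsFiniteType (F : OModuleOn O U) : Prop :=
  ∀ x ∈ U, ∃ (W : Opens α) (hW : W ≤ U), x ∈ W ∧
    ∃ (n : ℕ) (s : Fin n → F.sec W hW), F.Generates hW s

/-- The sheaf of relations between the finitely many sections `s` of `F` is locally
finitely generated. -/
def RelationsFiniteType (F : OModuleOn O U) {W : Opens α} (hW : W ≤ U) {n : ℕ}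
    (s : Fin n → F.sec W hW) : Prop :=
  ∀ x ∈ W, ∃ (V : Opens α) (hVW : V ≤ W), x ∈ V ∧
    ∃ (m : ℕ) (t : Fin m → (Fin n → O.obj (op V))),
      (∀ j, ∑ i, t j i • F.res hW hVW (s i) = 0) ∧
      ∀ (V' : Opens α) (h' : V' ≤ V) (a : Fin n → O.obj (op V')),
        (∑ i, a i • F.res hW (h'.trans hVW) (s i) = 0) →
        ∀ y ∈ V', ∃ (V'' : Opens α) (h'' : V'' ≤ V'), y ∈ V'' ∧
          ∃ c : Fin m → O.obj (op V''),
            ∀ i, O.map (homOfLE h'').op (a i) =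
              ∑ j, c j * O.map (homOfLE (h''.trans h')).op (t j i)

/-- `F` is coherent: it is of finite type, and the sheaf of relations between any finitely
many local sections is locally finitely generated. -/
def IsCoherent (F : OModuleOn O U) : Prop :=
  F.IsFiniteType ∧
    ∀ (W : Opens α) (hW : W ≤ U) (n : ℕ) (s : Fin n → F.sec W hW),
      F.RelationsFiniteType hW s

/-- `F` is torsion-free: on every open, the module of sections is torsion-free. -/
def IsTorsionFree (F : OModuleOn O U) : Prop :=
  ∀ (W : Opens α) (hW : W ≤ U) (r : O.obj (op W)) (s : F.sec W hW),
    r ∈ nonZeroDivisors (O.obj (op W)) → r • s = 0 → s = 0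

/-- Two (pre)sheaves of modules are isomorphic. -/
def AreIsomorphic (F G : OModuleOn O U) : Prop :=
  ∃ φ : OModuleHom F G, φ.IsIso

end OModuleOn

/-- The closed subset `T` of the topological space `S` has codimension at least two:
below every irreducible closed subset contained in `T` there is a chain of length two
of irreducible closed subsets of `S`. -/
def codimAtLeastTwo (S : Type*) [TopologicalSpace S] (T : Set S) : Prop :=
  ∀ C : TopologicalSpace.IrreducibleCloseds S, (C : Set S) ⊆ T → 2 ≤ Order.coheight C

/-- The subset `Z` of the topological space `X` has everywhere codimension at least two:
for every irreducible component `Y` of `X`, the codimension of `Z ∩ Y` in `Y` is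
at least two. -/
def hasEverywhereCodimAtLeastTwo {X : Type*} [TopologicalSpace X] (Z : Set X) : Prop :=
  ∀ Y ∈ irreducibleComponents X, codimAtLeastTwo Y (Subtype.val ⁻¹' Z)

/-- A (commutative, noetherian) local ring is regular if its maximal ideal is generated by
`dim R` many elements. -/
def IsRegularLocal (R : Type*) [CommRing R] [IsLocalRing R] : Prop :=
  IsNoetherianRing R ∧ ∃ (n : ℕ) (f : Fin n → R),
    Ideal.span (Set.range f) = IsLocalRing.maximalIdeal R ∧ (n : WithBot ℕ∞) = ringKrullDim R

/-- A commutative ring is regular if it is noetherian and all of its localizations at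
prime ideals are regular local rings. -/
def IsRegularCommRing (R : Type*) [CommRing R] : Prop :=
  IsNoetherianRing R ∧
    ∀ (P : Ideal R) [P.IsPrime], IsRegularLocal (Localization.AtPrime P)

open AlgebraicGeometry in
/-- A scheme is normal if all of its local rings are integrally closed domains. -/
def IsNormalScheme (X : Scheme) : Prop :=
  ∀ x : X, IsDomain (X.presheaf.stalk x) ∧ IsIntegrallyClosed (X.presheaf.stalk x)

open AlgebraicGeometry in
/-- A scheme is regular if all of its local rings are regular local rings. -/
def IsRegularScheme (X : Scheme) : Prop :=
  ∀ x : X, IsRegularLocal (X.presheaf.stalk x)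

namespace OModuleOn
variable {O : (Opens α)ᵒᵖ ⥤ CommRingCat.{u}} {U : Opens α}

/-- The sheaf condition (separation and gluing) for a presheaf of modules on `U`. -/
def IsSheaf (F : OModuleOn O U) : Prop :=
  ∀ (W : Opens α) (hW : W ≤ U) (S : Set (Opens α)) (hS : ∀ V ∈ S, V ≤ W), W ≤ sSup S →
    (∀ s : F.sec W hW, (∀ V (hV : V ∈ S), F.res hW (hS V hV) s = 0) → s = 0) ∧
    (∀ sf : ∀ V (hV : V ∈ S), F.sec V ((hS V hV).trans hW),
      (∀ V (hV : V ∈ S) (V' : Opens α) (hV' : V' ∈ S),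
        F.res ((hS V hV).trans hW) (inf_le_left : V ⊓ V' ≤ V) (sf V hV) =
        F.res ((hS V' hV').trans hW) (inf_le_right : V ⊓ V' ≤ V') (sf V' hV')) →
      ∃ s : F.sec W hW, ∀ V (hV : V ∈ S), F.res hW (hS V hV) s = sf V hV)

end OModuleOn

namespace OModuleOn
variable {O : (Opens α)ᵒᵖ ⥤ CommRingCat.{u}}

/-- The canonical morphism `R ⟶ i_* (R|_U)` (the unit of the adjunction), for a sheaf of
modules `R` on the whole space and an open subset `U`. -/
def restrictPushforwardUnit (R : OModuleOn O (⊤ : Opens α)) (U : Opens α) :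
    OModuleHom R ((R.restrictTo (le_top : U ≤ ⊤)).pushforward) where
  app V hV s := R.res hV (inf_le_right : U ⊓ V ≤ V) s
  app_add V hV s t := R.res_add hV inf_le_right s t
  app_smul V hV r s := R.res_smul hV inf_le_right r s
  naturality {V V'} hV h s := by
    show R.res (h.trans hV) inf_le_right (R.res hV h s) =
      R.res (le_top : U ⊓ V ≤ ⊤) (inf_le_inf_left U h) (R.res hV inf_le_right s)
    rw [R.res_comp, R.res_comp]

/-- The canonical comparison morphism `i_* Hom_{O_U}(i^* D, G) ⟶ Hom_{O_X}(D, i_* G)`. -/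
def homPushforwardCompare (U : Opens α) (D : OModuleOn O (⊤ : Opens α)) (G : OModuleOn O U) :
    OModuleHom ((sheafHom (D.restrictTo (le_top : U ≤ ⊤)) G).pushforward)
      (sheafHom D G.pushforward) where
  app V hV φ :=
    { app := fun W h d =>
        φ.app (U ⊓ W) (inf_le_inf_left U h) (D.res (h.trans hV) (inf_le_right : U ⊓ W ≤ W) d)
      app_add := fun W h d d' => by
        exact (congrArg (φ.app (U ⊓ W) (inf_le_inf_left U h))
          (D.res_add (h.trans hV) (inf_le_right : U ⊓ W ≤ W) d d')).trans
          (φ.app_add (U ⊓ W) (inf_le_inf_left U h) _ _)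
      app_smul := fun W h r d => by
        exact (congrArg (φ.app (U ⊓ W) (inf_le_inf_left U h))
          (D.res_smul (h.trans hV) (inf_le_right : U ⊓ W ≤ W) r d)).trans
          (φ.app_smul (U ⊓ W) (inf_le_inf_left U h) _ _)
      naturality := fun {W W'} h h' d => by
        show φ.app (U ⊓ W') (inf_le_inf_left U (h'.trans h))
            (D.res ((h'.trans h).trans hV) inf_le_right (D.res (h.trans hV) h' d)) =
          G.res inf_le_left (inf_le_inf_left U h')
            (φ.app (U ⊓ W) (inf_le_inf_left U h) (D.res (h.trans hV) inf_le_right d))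
        have := φ.naturality (inf_le_inf_left U h) (inf_le_inf_left U h')
          (D.res (h.trans hV) inf_le_right d)
        have h2 : ((D.restrictTo (le_top : U ≤ ⊤)).restrictTo
            (inf_le_left : U ⊓ V ≤ U)).res (inf_le_inf_left U h) (inf_le_inf_left U h')
            (D.res (h.trans hV) inf_le_right d) =
            D.res (h.trans hV) ((inf_le_inf_left U h').trans inf_le_right) d := by
          show D.res _ (inf_le_inf_left U h') (D.res (h.trans hV) inf_le_right d) = _
          exact D.res_comp (h.trans hV) inf_le_right (inf_le_inf_left U h') d
        exact (congrArg (φ.app (U ⊓ W') (inf_le_inf_left U (h'.trans h)))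
          ((D.res_comp (h.trans hV) h' inf_le_right d).trans h2.symm)).trans this }
  app_add V hV φ ψ := by
    apply OModuleHom.ext
    funext W h d
    rfl
  app_smul V hV r φ := by
    apply OModuleHom.ext
    funext W h d
    show O.map (homOfLE (inf_le_inf_left U h : U ⊓ W ≤ U ⊓ V)).op
        (O.map (homOfLE (inf_le_right : U ⊓ V ≤ V)).op r) •
        φ.app (U ⊓ W) (inf_le_inf_left U h) (D.res (h.trans hV) inf_le_right d) =
      O.map (homOfLE (inf_le_right : U ⊓ W ≤ W)).op (O.map (homOfLE h).op r) •
        φ.app (U ⊓ W) (inf_le_inf_left U h) (D.res (h.trans hV) inf_le_right d)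
    rw [map_map_apply, map_map_apply]
  naturality {V V'} hV h φ := by
    apply OModuleHom.ext
    funext W h' d
    show φ.app (U ⊓ W) ((inf_le_inf_left U h').trans (inf_le_inf_left U h))
        (D.res ((h'.trans h).trans hV) inf_le_right d) =
      φ.app (U ⊓ W) (inf_le_inf_left U (h'.trans h))
        (D.res ((h'.trans h).trans hV) inf_le_right d)
    rfl

end OModuleOn

open AlgebraicGeometry CategoryTheory



lemma hartogs_aux_local (B : Type*) [CommRing B] [IsDomain B] [IsLocalRing B] [IsNoetherianRing B]
    [IsIntegrallyClosed B] (a b : B) (hb : b ≠ 0) (hab : ¬ b ∣ a)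
    (hm : ∀ z ∈ IsLocalRing.maximalIdeal B, b ∣ z * a) :
    (IsLocalRing.maximalIdeal B).height ≤ 1 := by
  classical
  by_cases hbot : IsLocalRing.maximalIdeal B = ⊥
  · rw [hbot, Ideal.height_bot]; exact bot_le
  by_cases hcase : ∀ z ∈ IsLocalRing.maximalIdeal B, ∀ w, z * a = b * w →
      w ∈ IsLocalRing.maximalIdeal B
  · exfalso
    have hb' : algebraMap B (FractionRing B) b ≠ 0 := by simpa using hb
    have hint : IsIntegral B (algebraMap B (FractionRing B) a / algebraMap B (FractionRing B) b) := by
      refine isIntegral_of_smul_mem_submodule (M := FractionRing B)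
        (Submodule.map (Algebra.linearMap B (FractionRing B)) (IsLocalRing.maximalIdeal B)) ?_ ?_ _ ?_
      · intro h
        apply hbot
        rw [eq_bot_iff]
        intro z hz
        have : Algebra.linearMap B (FractionRing B) z ∈ (⊥ : Submodule B (FractionRing B)) :=
          h ▸ Submodule.mem_map_of_mem hz
        simpa using this
      · exact Submodule.FG.map _ (IsNoetherian.noetherian _)
      · rintro _ ⟨z, hz, rfl⟩
        obtain ⟨w, hw⟩ := hm z hz
        refine ⟨w, hcase z hz w hw, ?_⟩
        have : algebraMap B (FractionRing B) z * algebraMap B (FractionRing B) a = algebraMap B (FractionRing B) b * algebraMap B (FractionRing B) w := by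
          rw [← map_mul, ← map_mul, hw]
        simp only [Algebra.linearMap_apply, smul_eq_mul]
        field_simp
        linear_combination -this
    obtain ⟨c, hc⟩ := IsIntegrallyClosed.isIntegral_iff.mp hint
    apply hab
    refine ⟨c, ?_⟩
    apply IsFractionRing.injective B (FractionRing B)
    rw [map_mul, hc]
    field_simp
  · push Not at hcase
    obtain ⟨t, ht, w, hw, hwm⟩ := hcase
    have hwu : IsUnit w := by simpa using hwm
    have hspan : IsLocalRing.maximalIdeal B = Ideal.span {t} := by
      apply le_antisymm
      · intro z hz
        obtain ⟨v, hv⟩ := hm z hz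
        rw [Ideal.mem_span_singleton]
        obtain ⟨u, rfl⟩ := hwu
        refine ⟨v * ↑u⁻¹, ?_⟩
        have h1 : b * (z * u) = b * (t * v) := by linear_combination t * hv - z * hw
        have h2 := mul_left_cancel₀ hb h1
        calc z = (z * u) * ↑u⁻¹ := by simp [mul_assoc]
          _ = _ := by rw [h2, mul_assoc]
      · rw [Ideal.span_singleton_le_iff_mem]; exact ht
    apply Ideal.height_le_one_of_isPrincipal_of_mem_minimalPrimes_of_isLocalRing
      (Ideal.span {t})
    rw [← hspan, Ideal.minimalPrimes_eq_subsingleton_self]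
    rfl

lemma hartogs_aux (A : Type*) [CommRing A] [IsDomain A] [IsNoetherianRing A]
    (hA : ∀ (P : Ideal A) [P.IsPrime], IsIntegrallyClosed (Localization.AtPrime P))
    (P : Ideal A) [P.IsPrime] (a b : A) (hb : b ≠ 0) (hP : ∀ z, z ∈ P ↔ b ∣ z * a) :
    P.height ≤ 1 := by
  have := hA P
  let B := Localization.AtPrime P
  have hinj : Function.Injective (algebraMap A B) :=
    IsLocalization.injective B (Ideal.primeCompl_le_nonZeroDivisors P)
  have : IsDomain B := IsLocalization.isDomain_localization
    (Ideal.primeCompl_le_nonZeroDivisors P)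
  have : IsNoetherianRing B := IsLocalization.isNoetherianRing P.primeCompl B inferInstance
  have h := hartogs_aux_local B (algebraMap A B a) (algebraMap A B b)
    (by rwa [Ne, map_eq_zero_iff _ hinj]) ?_ ?_
  · have h3 := IsLocalization.AtPrime.ringKrullDim_eq_height P B
    rw [← IsLocalRing.maximalIdeal_height_eq_ringKrullDim] at h3
    rwa [← WithBot.coe_injective h3]
  · rintro ⟨w, hw⟩
    obtain ⟨⟨c, s⟩, hs⟩ := IsLocalization.surj P.primeCompl w
    have : s.1 ∈ P := (hP _).2 ⟨c, hinj (by
      rw [map_mul, map_mul, ← hs, hw]; ring)⟩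
    exact s.2 this
  · intro z hz
    obtain ⟨⟨c, s⟩, hs⟩ := IsLocalization.surj P.primeCompl z
    have hu : IsUnit (algebraMap A B s) := IsLocalization.map_units B s
    have hc : c ∈ P := by
      have : algebraMap A B c ∈ IsLocalRing.maximalIdeal B := by
        rw [← hs]; exact Ideal.mul_mem_right _ _ hz
      exact (IsLocalization.AtPrime.to_map_mem_maximal_iff B P c).mp this
    obtain ⟨d, hd⟩ := (hP c).1 hc
    obtain ⟨u, hu⟩ := hu
    refine ⟨algebraMap A B d * ↑u⁻¹, ?_⟩
    dsimp only at hs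
    rw [← hu] at hs
    have : algebraMap A B c * algebraMap A B a = algebraMap A B b * algebraMap A B d := by
      rw [← map_mul, hd, map_mul]
    have hz : z = algebraMap A B c * ↑u⁻¹ := by rw [← hs]; simp [mul_assoc]
    rw [hz]; linear_combination (↑u⁻¹ : B) * this

lemma hartogs_alg (A : Type*) [CommRing A] [IsDomain A] [IsNoetherianRing A]
    (hA : ∀ (P : Ideal A) [P.IsPrime], IsIntegrallyClosed (Localization.AtPrime P))
    (a b : A) (hb : b ≠ 0)
    (h : ∀ P : Ideal A, P.IsPrime → P.height ≤ 1 → ∃ t ∉ P, b ∣ t * a) : b ∣ a := by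
  by_contra hab
  obtain ⟨P, hP, hle⟩ := exists_le_isAssociatedPrime_of_isNoetherianRing A
    (M := A ⧸ Ideal.span {b}) (Ideal.Quotient.mk _ a)
    (by rwa [Ne, Ideal.Quotient.eq_zero_iff_mem, Ideal.mem_span_singleton])
  rw [isAssociatedPrime_iff] at hP
  obtain ⟨hPp, y, hy⟩ := hP
  obtain ⟨y, rfl⟩ := Ideal.Quotient.mk_surjective y
  have key : ∀ (x z : A), z ∈ (⊥ : Submodule A (A ⧸ Ideal.span {b})).colon
      {Ideal.Quotient.mk (Ideal.span {b}) x} ↔ b ∣ z * x := by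
    intro x z
    rw [Submodule.mem_colon_singleton, Submodule.mem_bot, ← Ideal.mem_span_singleton,
      ← Ideal.Quotient.eq_zero_iff_mem, map_mul]
    rfl
  obtain ⟨t, ht, hta⟩ := h P hPp (hartogs_aux A hA P y b hb (fun z => by rw [← key, hy]))
  exact ht (hle ((key _ _).2 hta))


/-- Sections over opens in `V` are determined on dense opens. -/
def IntgOn (X : Scheme.{u}) (V : X.Opens) : Prop :=
  ∀ (W D : X.Opens), W ≤ V → D ≤ V → D ≠ ⊥ → ∀ a : X.presheaf.obj (op W),
    X.presheaf.map (homOfLE (inf_le_left : W ⊓ D ≤ W)).op a = 0 → a = 0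

lemma intgOn_mono {X : Scheme.{u}} {V V' : X.Opens} (h : V' ≤ V) (hV : IntgOn X V) :
    IntgOn X V' := fun W D hW hD => hV W D (hW.trans h) (hD.trans h)

lemma intgOn_of_isDomain {X : Scheme.{u}} {V : X.Opens} (hV : IsAffineOpen V)
    [IsDomain Γ(X, V)] : IntgOn X V := by
  intro W D hW hD hDne a ha
  by_cases hWne : W = ⊥
  · subst hWne
    exact Subsingleton.elim _ _
  have hne : ∀ T : X.Opens, T ≤ V → T ≠ ⊥ → Nonempty (V.ι ⁻¹ᵁ T) := by
    intro T hT hTne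
    obtain ⟨x, hx⟩ := (Opens.ne_bot_iff_nonempty T).mp hTne
    exact ⟨⟨⟨x, hT hx⟩, hx⟩⟩
  have := hne W hW hWne
  have := hne D hD hDne
  have : IsAffine V := hV
  have : Nonempty V := ⟨(hne W hW hWne).some.1⟩
  have : IsDomain Γ(V, ⊤) :=
    MulEquiv.isDomain Γ(X, V) V.topIso.commRingCatIsoToRingEquiv.toMulEquiv
  have : IsIntegral V := isIntegral_of_isAffine_of_isDomain _
  have hne2 : Nonempty (V.ι ⁻¹ᵁ (W ⊓ D) : V.toScheme.Opens) := by
    obtain ⟨x, hx⟩ := hne W hW hWne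
    obtain ⟨y, hy⟩ := hne D hD hDne
    obtain ⟨z, hz⟩ := nonempty_preirreducible_inter (V.ι ⁻¹ᵁ W).isOpen (V.ι ⁻¹ᵁ D).isOpen
      ⟨x, hx⟩ ⟨y, hy⟩
    exact ⟨⟨z, hz⟩⟩
  have hle : V.ι ⁻¹ᵁ (W ⊓ D) ≤ V.ι ⁻¹ᵁ W := fun z hz => hz.1
  have hinj := map_injective_of_isIntegral V.toScheme (homOfLE hle)
  have h1 : IsIso (V.ι.app W) := V.ι.isIso_app W (by simpa using hW)
  have h2 : Function.Injective (V.ι.app W) := (ConcreteCategory.bijective_of_isIso _).1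
  apply h2
  apply hinj
  have := V.ι.naturality (homOfLE (inf_le_left : W ⊓ D ≤ W)).op
  have h3 := congrArg (fun f => f.hom a) this
  simp only [CommRingCat.hom_comp, RingHom.comp_apply] at h3
  rw [ha, map_zero] at h3
  rw [map_zero, map_zero]
  exact h3.symm

lemma exists_good_nbhd {X : Scheme.{u}} [IsLocallyNoetherian X] (hX : IsNormalScheme X)
    (x : X) (N : X.Opens) (hx : x ∈ N) : ∃ V : X.Opens, x ∈ V ∧ V ≤ N ∧ IsAffineOpen V ∧
      IsDomain Γ(X, V) ∧ IsNoetherianRing Γ(X, V) ∧ IntgOn X V := by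
  obtain ⟨V, hxV, hV, hVN, hinj⟩ := X.exists_le_and_germ_injective x N hx
  have := (hX x).1
  have hd : IsDomain Γ(X, V) := Function.Injective.isDomain (X.presheaf.germ V x hxV).hom hinj
  exact ⟨V, hxV, hVN, hV, hd, IsLocallyNoetherian.component_noetherian ⟨V, hV⟩,
    intgOn_of_isDomain hV⟩

lemma isUnit_res_basicOpen {X : Scheme.{u}} {V : X.Opens} (g : Γ(X, V)) :
    IsUnit (X.presheaf.map (homOfLE (X.basicOpen_le g)).op g) :=
  RingedSpace.isUnit_res_basicOpen X.toLocallyRingedSpace.toRingedSpace g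

lemma exists_pow_mul_lift {X : Scheme.{u}} {V : X.Opens} (hV : IsAffineOpen V) (g : Γ(X, V))
    (D : X.Opens) (hD : D = X.basicOpen g) (hDV : D ≤ V) (a : X.presheaf.obj (op D)) :
    ∃ (k : ℕ) (b : Γ(X, V)), X.presheaf.map (homOfLE hDV).op b =
      (X.presheaf.map (homOfLE hDV).op g) ^ k * a := by
  subst hD
  have := hV.isLocalization_basicOpen g
  obtain ⟨n, b, hb⟩ := IsLocalization.Away.surj g a
  refine ⟨n, b, ?_⟩
  rw [mul_comm]
  exact hb.symm

lemma isSheaf_unit_glue {X : Scheme.{u}} (W : X.Opens) (T : W → X.Opens) (hT : ∀ y, T y ≤ W)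
    (hy : ∀ y : W, y.1 ∈ T y) (w : ∀ y, X.presheaf.obj (op (T y)))
    (hw : ∀ y z, X.presheaf.map (homOfLE (inf_le_left : T y ⊓ T z ≤ T y)).op (w y) =
      X.presheaf.map (homOfLE (inf_le_right : T y ⊓ T z ≤ T z)).op (w z)) :
    ∃ a : X.presheaf.obj (op W), ∀ y, X.presheaf.map (homOfLE (hT y)).op a = w y := by
  obtain ⟨a, ha, -⟩ := X.sheaf.existsUnique_gluing' T W (fun y => homOfLE (hT y))
    (fun y hyW => by
      simp only [Opens.mem_iSup]
      exact ⟨⟨y, hyW⟩, hy ⟨y, hyW⟩⟩) w (fun y z => hw y z)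
  exact ⟨a, ha⟩

lemma eq_of_locally {X : Scheme.{u}} (W : X.Opens) (a b : X.presheaf.obj (op W))
    (h : ∀ y ∈ W, ∃ (T : X.Opens) (hT : T ≤ W), y ∈ T ∧
      X.presheaf.map (homOfLE hT).op a = X.presheaf.map (homOfLE hT).op b) : a = b := by
  choose T hT hy he using h
  refine X.sheaf.eq_of_locally_eq' (fun y : W => T y.1 y.2) W (fun y => homOfLE (hT _ _))
    (fun y hyW => by
      simp only [Opens.mem_iSup]
      exact ⟨⟨y, hyW⟩, hy _ hyW⟩) a b (fun y => he _ _)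


lemma fromSpec_mem_of_height_le_one {X : Scheme.{u}} {U : X.Opens}
    (hZ : hasEverywhereCodimAtLeastTwo ((U : Set X)ᶜ)) {V : X.Opens} (hV : IsAffineOpen V)
    (P : PrimeSpectrum Γ(X, V)) (hP : P.asIdeal.height ≤ 1) : hV.fromSpec P ∈ U := by
  by_contra hyU
  set y : X := hV.fromSpec P with hy
  have hyV : y ∈ V := by
    have : hV.fromSpec P ∈ Set.range hV.fromSpec := ⟨P, rfl⟩
    rw [hV.range_fromSpec] at this
    exact this
  let Y : Set X := irreducibleComponent y
  have hY : Y ∈ irreducibleComponents X := irreducibleComponent_mem_irreducibleComponents y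
  have hYc : IsClosed Y := isClosed_irreducibleComponent
  let y' : Y := ⟨y, mem_irreducibleComponent⟩
  let C : IrreducibleCloseds Y := ⟨closure {y'}, isIrreducible_singleton.closure, isClosed_closure⟩
  have hC : (C : Set Y) ⊆ Subtype.val ⁻¹' ((U : Set X)ᶜ) := by
    apply closure_minimal
    · rintro _ rfl
      exact hyU
    · exact (U.isOpen.isClosed_compl).preimage continuous_subtype_val
  have h2 := hZ Y hY C hC
  obtain ⟨s, hs0, hs2⟩ := Order.exists_series_of_le_coheight C (n := 2) h2
  have hgen : ∀ T : IrreducibleCloseds Y, ∃ c : X, closure {c} = Subtype.val '' (T : Set Y) := by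
    intro T
    have hirr : IsIrreducible (Subtype.val '' (T : Set Y)) :=
      T.isIrreducible.image _ continuous_subtype_val.continuousOn
    have hcl : IsClosed (Subtype.val '' (T : Set Y)) :=
      hYc.isClosedMap_subtype_val _ T.isClosed
    exact ⟨hirr.genericPoint, by rw [hirr.genericPoint_closure_eq, hcl.closure_eq]⟩
  have hlt : ∀ T T' : IrreducibleCloseds Y, T < T' →
      (Subtype.val '' (T : Set Y) : Set X) ⊂ Subtype.val '' (T' : Set Y) := by
    intro T T' h
    exact Subtype.val_injective.image_strictMono h
  have hspec : ∀ a b : X, closure {a} ⊂ closure {b} → b ⤳ a ∧ ¬ a ⤳ b := by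
    intro a b h
    rw [specializes_iff_closure_subset, specializes_iff_closure_subset]
    exact ⟨h.1, h.2⟩
  obtain ⟨c1, hc1⟩ := hgen (s ⟨1, by omega⟩)
  obtain ⟨c2, hc2⟩ := hgen (s ⟨2, by omega⟩)
  have hc0 : closure {y} = Subtype.val '' (C : Set Y) := by
    show closure {y} = Subtype.val '' closure {y'}
    rw [← hYc.isClosedEmbedding_subtypeVal.closure_image_eq, Set.image_singleton]
  have h01 : C < s ⟨1, by omega⟩ := by
    rw [← hs0]
    exact s.strictMono (by simp [Fin.lt_def])
  have h12 : s ⟨1, by omega⟩ < s ⟨2, by omega⟩ := s.strictMono (by simp)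
  have H1 := hspec y c1 (by rw [hc0, hc1]; exact hlt _ _ h01)
  have H2 := hspec c1 c2 (by rw [hc1, hc2]; exact hlt _ _ h12)
  have hc1V : c1 ∈ V := H1.1.mem_open V.isOpen hyV
  have hc2V : c2 ∈ V := H2.1.mem_open V.isOpen hc1V
  have hpt : ∀ c ∈ V, ∃ Q : PrimeSpectrum Γ(X, V), hV.fromSpec Q = c := by
    intro c hc
    exact ⟨hV.primeIdealOf ⟨c, hc⟩, hV.fromSpec_primeIdealOf ⟨c, hc⟩⟩
  obtain ⟨P1, rfl⟩ := hpt c1 hc1V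
  obtain ⟨P2, rfl⟩ := hpt c2 hc2V
  have hind := hV.fromSpec.isOpenEmbedding.isInducing
  have key : ∀ Q Q' : PrimeSpectrum Γ(X, V), (hV.fromSpec Q ⤳ hV.fromSpec Q') ↔ Q ≤ Q' := by
    intro Q Q'
    rw [PrimeSpectrum.le_iff_specializes]
    exact hind.specializes_iff
  rw [hy, key, key] at H1
  rw [key, key] at H2
  have l1 : P1.asIdeal < P.asIdeal := lt_of_le_not_ge H1.1 H1.2
  have l2 : P2.asIdeal < P1.asIdeal := lt_of_le_not_ge H2.1 H2.2
  have m1 := Ideal.height_add_one_le_of_lt_of_isPrime l1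
  have m2 := Ideal.height_add_one_le_of_lt_of_isPrime l2
  have : (1 : ℕ∞) + 1 ≤ 1 := by
    refine le_trans ?_ (m1.trans hP)
    gcongr
    refine le_trans ?_ m2
    simp
  norm_num at this

lemma inf_ne_bot {X : Scheme.{u}} {U : X.Opens}
    (hZ : hasEverywhereCodimAtLeastTwo ((U : Set X)ᶜ)) {V : X.Opens} (hV : IsAffineOpen V)
    [IsDomain Γ(X, V)] : U ⊓ V ≠ ⊥ := by
  rw [Opens.ne_bot_iff_nonempty]
  let P : PrimeSpectrum Γ(X, V) := ⟨⊥, Ideal.isPrime_bot⟩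
  refine ⟨hV.fromSpec P, fromSpec_mem_of_height_le_one hZ hV P ?_, ?_⟩
  · show (⊥ : Ideal Γ(X, V)).height ≤ 1
    rw [Ideal.height_bot]; exact bot_le
  · have : hV.fromSpec P ∈ Set.range hV.fromSpec := ⟨P, rfl⟩
    rw [hV.range_fromSpec] at this
    exact this

lemma hartogs_scheme {X : Scheme.{u}} (hX : IsNormalScheme X) {U : X.Opens}
    (hZ : hasEverywhereCodimAtLeastTwo ((U : Set X)ᶜ)) {V : X.Opens} (hV : IsAffineOpen V)
    [IsDomain Γ(X, V)] [IsNoetherianRing Γ(X, V)] (hI : IntgOn X V) :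
    Function.Surjective (X.presheaf.map (homOfLE (inf_le_right : U ⊓ V ≤ V)).op) := by
  intro f
  obtain ⟨x, hx⟩ := (Opens.ne_bot_iff_nonempty _).mp (inf_ne_bot hZ hV)
  -- near every point of `U ⊓ V`, `f` is a fraction
  have hfrac : ∀ y ∈ U ⊓ V, ∃ (t : Γ(X, V)) (k : ℕ) (e : Γ(X, V)), y ∈ X.basicOpen t ∧
      X.presheaf.map (homOfLE (inf_le_right : U ⊓ V ≤ V)).op (t ^ k) * f =
        X.presheaf.map (homOfLE (inf_le_right : U ⊓ V ≤ V)).op e := by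
    intro y hy
    obtain ⟨t, ht, hyt⟩ := hV.exists_basicOpen_le ⟨y, hy⟩ hy.2
    obtain ⟨k, e, he⟩ := exists_pow_mul_lift hV t (X.basicOpen t) rfl (X.basicOpen_le t)
      (X.presheaf.map (homOfLE ht).op f)
    refine ⟨t, k, e, hyt, ?_⟩
    rw [← sub_eq_zero]
    apply hI (U ⊓ V) (X.basicOpen t) inf_le_right (X.basicOpen_le t)
      (by rw [Opens.ne_bot_iff_nonempty]; exact ⟨y, hyt⟩)
    have h1 : (U ⊓ V) ⊓ X.basicOpen t ≤ X.basicOpen t := inf_le_right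
    have := congrArg (X.presheaf.map (homOfLE h1).op) he
    simp only [map_sub, map_mul, map_pow, map_map_apply] at this ⊢
    rw [this]
    exact sub_self _
  obtain ⟨h, k, a, hxh, ha⟩ := hfrac x hx
  have hne : X.basicOpen h ≠ ⊥ := by rw [Opens.ne_bot_iff_nonempty]; exact ⟨x, hxh⟩
  have hh : h ≠ 0 := by
    rintro rfl
    exact hne (X.basicOpen_zero V)
  have hinj : ∀ c : Γ(X, V), X.presheaf.map (homOfLE (inf_le_right : U ⊓ V ≤ V)).op c = 0 →
      c = 0 := by
    intro c hc
    apply hI V (U ⊓ V) le_rfl inf_le_right (inf_ne_bot hZ hV)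
    have h1 : V ⊓ (U ⊓ V) ≤ U ⊓ V := inf_le_right
    have := congrArg (X.presheaf.map (homOfLE h1).op) hc
    simpa only [map_map_apply, map_zero] using this
  have hdvd : h ^ k ∣ a := by
    apply hartogs_alg Γ(X, V) ?_ a (h ^ k) (pow_ne_zero _ hh)
    · intro P hP hht
      let P' : PrimeSpectrum Γ(X, V) := ⟨P, hP⟩
      have hyU := fromSpec_mem_of_height_le_one hZ hV P' hht
      have hyV : hV.fromSpec P' ∈ V := by
        have : hV.fromSpec P' ∈ Set.range hV.fromSpec := ⟨P', rfl⟩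
        rw [hV.range_fromSpec] at this
        exact this
      obtain ⟨t, l, e, hyt, he⟩ := hfrac _ ⟨hyU, hyV⟩
      have htP : t ∉ P := by
        have : P' ∈ hV.fromSpec ⁻¹ᵁ X.basicOpen t := hyt
        rw [hV.fromSpec_preimage_basicOpen] at this
        exact this
      refine ⟨t ^ l, fun hc => htP (hP.mem_of_pow_mem _ hc), e, ?_⟩
      rw [← sub_eq_zero]
      apply hinj
      rw [map_sub, map_mul, map_mul, ← ha, ← he]
      ring
    · intro P hP
      let P' : PrimeSpectrum Γ(X, V) := ⟨P, hP⟩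
      have hyV : hV.fromSpec P' ∈ V := by
        have : hV.fromSpec P' ∈ Set.range hV.fromSpec := ⟨P', rfl⟩
        rw [hV.range_fromSpec] at this
        exact this
      have := (hX (hV.fromSpec P')).2
      let := TopCat.Presheaf.algebra_section_stalk X.presheaf ⟨hV.fromSpec P', hyV⟩
      have h1 : IsLocalization P.primeCompl (X.presheaf.stalk (hV.fromSpec P')) :=
        hV.isLocalization_stalk' P' hyV
      exact IsIntegrallyClosed.of_equiv
        (IsLocalization.algEquiv P.primeCompl (X.presheaf.stalk (hV.fromSpec P'))
          (Localization.AtPrime P)).toRingEquiv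
  obtain ⟨c, rfl⟩ := hdvd
  refine ⟨c, ?_⟩
  rw [← sub_eq_zero]
  apply hI (U ⊓ V) (X.basicOpen h) inf_le_right (X.basicOpen_le h) hne
  have hu := (isUnit_res_basicOpen h).map
    (X.presheaf.map (homOfLE (inf_le_right : (U ⊓ V) ⊓ X.basicOpen h ≤ _)).op).hom
  have := congrArg (X.presheaf.map (homOfLE (inf_le_left : (U ⊓ V) ⊓ X.basicOpen h ≤ _)).op) ha
  have hu' := hu.pow k
  apply hu'.mul_left_cancel
  rw [mul_zero]
  rw [map_sub, mul_sub]
  simp only [map_mul, map_pow, map_map_apply] at this ⊢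
  rw [← this, sub_self]


namespace OModuleOn
variable {O : (Opens α)ᵒᵖ ⥤ CommRingCat.{u}} {U : Opens α}

lemma res_eq_of_le (F : OModuleOn O U) {W W' W'' : Opens α} (hW : W ≤ U) (h : W' ≤ W)
    (h' : W'' ≤ W') {s t : F.sec W hW} (hst : F.res hW h s = F.res hW h t) :
    F.res hW (h'.trans h) s = F.res hW (h'.trans h) t := by
  rw [← F.res_comp hW h h', hst, F.res_comp]

lemma pushforward_isSheaf (F : OModuleOn O U) (hF : F.IsSheaf) : F.pushforward.IsSheaf := by
  classical
  intro W hW S hS hcov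
  let S' : Set (Opens α) := (fun V => U ⊓ V) '' S
  have hS' : ∀ T ∈ S', T ≤ U ⊓ W := by
    rintro _ ⟨V, hV, rfl⟩
    exact inf_le_inf_left U (hS V hV)
  have hcov' : U ⊓ W ≤ sSup S' := by
    rintro x ⟨hxU, hxW⟩
    have h1 : x ∈ sSup S := hcov hxW
    rw [Opens.mem_sSup] at h1
    obtain ⟨V, hV, hxV⟩ := h1
    have h2 : x ∈ U ⊓ V := ⟨hxU, hxV⟩
    exact (le_sSup (show U ⊓ V ∈ S' from ⟨V, hV, rfl⟩)) h2
  obtain ⟨hsep, hglue⟩ := hF (U ⊓ W) inf_le_left S' hS' hcov'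
  constructor
  · intro s hs
    apply hsep s
    rintro _ ⟨V, hV, rfl⟩
    exact hs V hV
  · intro sf hsf
    have hch : ∀ T ∈ S', ∃ V, V ∈ S ∧ T ≤ U ⊓ V := by
      rintro _ ⟨V, hV, rfl⟩
      exact ⟨V, hV, le_rfl⟩
    choose c hc hcT using hch
    obtain ⟨s, hs⟩ := hglue (fun T hT => F.res inf_le_left (hcT T hT) (sf (c T hT) (hc T hT))) (by
      intro T hT T' hT'
      have h1 : F.res (inf_le_left : U ⊓ c T hT ≤ U)
          (inf_le_inf_left U (inf_le_left : c T hT ⊓ c T' hT' ≤ c T hT)) (sf (c T hT) (hc T hT)) =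
          F.res (inf_le_left : U ⊓ c T' hT' ≤ U)
          (inf_le_inf_left U (inf_le_right : c T hT ⊓ c T' hT' ≤ c T' hT'))
            (sf (c T' hT') (hc T' hT')) := hsf _ (hc T hT) _ (hc T' hT')
      have hle : T ⊓ T' ≤ U ⊓ (c T hT ⊓ c T' hT') := fun x hx =>
        ⟨(hcT T hT hx.1).1, (hcT T hT hx.1).2, (hcT T' hT' hx.2).2⟩
      have h2 := congrArg (F.res (inf_le_left) hle) h1
      have h3 := ((F.res_comp _ _ _ _).symm.trans h2).trans (F.res_comp _ _ _ _)
      exact (F.res_comp _ _ _ _).trans (h3.trans (F.res_comp _ _ _ _).symm))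
    refine ⟨s, fun V hV => ?_⟩
    have hT : U ⊓ V ∈ S' := ⟨V, hV, rfl⟩
    have h0 : F.res inf_le_left (inf_le_inf_left U (hS V hV)) s = _ := hs (U ⊓ V) hT
    refine h0.trans ?_
    have h1 : F.res (inf_le_left : U ⊓ c _ hT ≤ U)
          (inf_le_inf_left U (inf_le_left : c _ hT ⊓ V ≤ c _ hT)) (sf (c _ hT) (hc _ hT)) =
          F.res (inf_le_left : U ⊓ V ≤ U)
          (inf_le_inf_left U (inf_le_right : c _ hT ⊓ V ≤ V))
            (sf V hV) := hsf _ (hc _ hT) _ hV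
    have hle : U ⊓ V ≤ U ⊓ (c _ hT ⊓ V) := fun x hx => ⟨hx.1, (hcT _ hT hx).2, hx.2⟩
    have h2 := congrArg (F.res (inf_le_left) hle) h1
    exact ((F.res_comp _ _ _ _).symm.trans h2).trans ((F.res_comp _ _ _ _).trans (F.res_id _ _ _))

/-- Extend a functional on `F|_W`, `W ≤ U`, to one on `(i_* F)|_W`. -/
def tildeDual (F : OModuleOn O U) (W : Opens α) (hW : W ≤ U) (ψ : F.dual.sec W hW) :
    F.pushforward.dual.sec W le_top where
  app W' h' s := O.map (homOfLE (le_inf (h'.trans hW) le_rfl : W' ≤ U ⊓ W')).op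
    (ψ.app (U ⊓ W') (inf_le_right.trans h') s)
  app_add W' h' s t := by
    have := ψ.app_add (U ⊓ W') (inf_le_right.trans h') s t
    exact (congrArg (O.map (homOfLE (le_inf (h'.trans hW) le_rfl : W' ≤ U ⊓ W')).op) this).trans
      (map_add _ _ _)
  app_smul W' h' r s := by
    have := ψ.app_smul (U ⊓ W') (inf_le_right.trans h')
      (O.map (homOfLE (inf_le_right : U ⊓ W' ≤ W')).op r) s
    refine (congrArg (O.map (homOfLE (le_inf (h'.trans hW) le_rfl : W' ≤ U ⊓ W')).op)
      this).trans ?_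
    refine (map_mul _ _ _).trans ?_
    rw [map_map_apply, map_id_apply]
    rfl
  naturality {W' W''} h' h'' s := by
    have := ψ.naturality (inf_le_right.trans h') (inf_le_inf_left U h'') s
    refine (congrArg (O.map (homOfLE (le_inf ((h''.trans h').trans hW) le_rfl :
      W'' ≤ U ⊓ W'')).op) this).trans ?_
    refine (map_map_apply O (inf_le_inf_left U h'') _ _).trans ?_
    exact (map_map_apply O _ h'' _).symm

/-- Restrict a functional on `(i_* F)|_W` to one on `F|_{U ⊓ W}`. -/
def untildeDual (F : OModuleOn O U) (W : Opens α) (φ : F.pushforward.dual.sec W le_top) :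
    F.dual.sec (U ⊓ W) inf_le_left where
  app W' h' s := φ.app W' (h'.trans inf_le_right)
    (F.res (h'.trans inf_le_left) (inf_le_right : U ⊓ W' ≤ W') s)
  app_add W' h' s t := by
    refine (congrArg (φ.app W' (h'.trans inf_le_right)) (F.res_add _ _ _ _)).trans ?_
    exact φ.app_add _ _ _ _
  app_smul W' h' r s := by
    refine (congrArg (φ.app W' (h'.trans inf_le_right)) (F.res_smul _ _ _ _)).trans ?_
    exact φ.app_smul W' (h'.trans inf_le_right) r _
  naturality {W' W''} h' h'' s := by
    refine Eq.trans ?_ (φ.naturality (h'.trans inf_le_right) h''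
      (F.res (h'.trans inf_le_left) (inf_le_right : U ⊓ W' ≤ W') s))
    refine congrArg (φ.app W'' ((h''.trans h').trans inf_le_right)) ?_
    refine (F.res_comp (h'.trans inf_le_left) h'' (inf_le_right : U ⊓ W'' ≤ W'') s).trans ?_
    exact (F.res_comp (h'.trans inf_le_left) (inf_le_right : U ⊓ W' ≤ W')
      (inf_le_inf_left U h'') s).symm

lemma tilde_untilde (F : OModuleOn O U) (W : Opens α) (φ : F.pushforward.dual.sec W le_top) :
    F.tildeDual (U ⊓ W) inf_le_left (F.untildeDual W φ) =
      F.pushforward.dual.res le_top (inf_le_right : U ⊓ W ≤ W) φ := by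
  apply OModuleHom.ext
  funext W' h' s
  have h1 : W' ≤ U ⊓ W' := le_inf (h'.trans inf_le_left) le_rfl
  have := φ.naturality (W := U ⊓ W') (W' := W') (inf_le_right.trans (h'.trans inf_le_right)) h1
    (F.res inf_le_left (inf_le_right : U ⊓ (U ⊓ W') ≤ U ⊓ W') s)
  refine Eq.trans this.symm ?_
  refine congrArg (φ.app W' (h'.trans inf_le_right)) ?_
  refine (F.res_comp inf_le_left (inf_le_right : U ⊓ (U ⊓ W') ≤ U ⊓ W')
    (inf_le_inf_left U h1) s).trans ?_
  exact F.res_id _ _ _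

lemma pushforward_isReflexive (F : OModuleOn O U) (hF : F.IsReflexive)
    (hinj : ∀ (W : Opens α) (a : O.obj (op W)),
      O.map (homOfLE (inf_le_right : U ⊓ W ≤ W)).op a = 0 → a = 0) :
    F.pushforward.IsReflexive := by
  intro V hV
  constructor
  · intro s t hst
    apply (hF (U ⊓ V) inf_le_left).1
    apply OModuleHom.ext
    funext W h ψ
    have h1 := congrArg (fun Φ : F.pushforward.bidual.sec V hV =>
      Φ.app W (h.trans inf_le_right) (F.tildeDual W (h.trans inf_le_left) ψ)) hst
    have hWU : W ≤ U := h.trans inf_le_left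
    have h2 : ∀ s : F.sec (U ⊓ V) inf_le_left,
        O.map (homOfLE (le_inf hWU le_rfl : W ≤ U ⊓ W)).op
          (ψ.app (U ⊓ W) inf_le_right (F.res inf_le_left
            (inf_le_inf_left U (h.trans inf_le_right)) s)) =
        ψ.app W le_rfl (F.res inf_le_left h s) := by
      intro s
      have hh : W ≤ U ⊓ W := le_inf hWU le_rfl
      have := ψ.naturality (W := U ⊓ W) (W' := W) inf_le_right hh
        (F.res inf_le_left (inf_le_inf_left U (h.trans inf_le_right)) s)
      refine this.symm.trans ?_
      exact congrArg (ψ.app W le_rfl) (F.res_comp _ _ _ _)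
    exact ((h2 s).symm.trans h1).trans (h2 t)
  · intro Φ
    let Ψ : F.bidual.sec (U ⊓ V) inf_le_left :=
      { app := fun W h ψ => Φ.app W (h.trans inf_le_right) (F.tildeDual W (h.trans inf_le_left) ψ)
        app_add := by
          intro W h ψ ψ'
          refine Eq.trans ?_ (Φ.app_add W (h.trans inf_le_right) _ _)
          refine congrArg (Φ.app W (h.trans inf_le_right)) ?_
          apply OModuleHom.ext
          funext W' h' s
          exact map_add (O.map _).hom _ _
        app_smul := by
          intro W h r ψ
          refine Eq.trans ?_ (Φ.app_smul W (h.trans inf_le_right) r _)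
          refine congrArg (Φ.app W (h.trans inf_le_right)) ?_
          apply OModuleHom.ext
          funext W' h' s
          refine (map_mul (O.map _).hom _ _).trans ?_
          refine congrArg₂ (· * ·) ?_ rfl
          exact map_map_apply O _ _ r
        naturality := by
          intro W W' h h' ψ
          refine Eq.trans ?_ (Φ.naturality (h.trans inf_le_right) h' _)
          rfl }
    obtain ⟨s, hs⟩ := (hF (U ⊓ V) inf_le_left).2 Ψ
    refine ⟨s, ?_⟩
    apply OModuleHom.ext
    funext W h φ
    have hW : W ≤ V := h
    have hinj' : ∀ (W : Opens α) (a b : O.obj (op W)),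
        O.map (homOfLE (inf_le_right : U ⊓ W ≤ W)).op a =
          O.map (homOfLE (inf_le_right : U ⊓ W ≤ W)).op b → a = b := by
      intro W a b hab
      rw [← sub_eq_zero]
      apply hinj
      rw [map_sub, hab, sub_self]
    refine hinj' W _ _ ?_
    have hUW : U ⊓ W ≤ U ⊓ V := inf_le_inf_left U h
    have h1 := congrArg (fun Θ : F.bidual.sec (U ⊓ V) inf_le_left =>
      Θ.app (U ⊓ W) hUW (F.untildeDual W φ)) hs
    have h2 : Φ.app (U ⊓ W) (inf_le_right.trans h)
        (F.tildeDual (U ⊓ W) inf_le_left (F.untildeDual W φ)) =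
        O.map (homOfLE (inf_le_right : U ⊓ W ≤ W)).op (Φ.app W h φ) := by
      refine (congrArg (Φ.app (U ⊓ W) (inf_le_right.trans h)) (F.tilde_untilde W φ)).trans ?_
      exact Φ.naturality h (inf_le_right : U ⊓ W ≤ W) φ
    have h3 : φ.app (U ⊓ W) inf_le_right (F.res (inf_le_left : U ⊓ W ≤ U)
        (inf_le_right : U ⊓ (U ⊓ W) ≤ U ⊓ W) (F.res inf_le_left hUW s)) =
        O.map (homOfLE (inf_le_right : U ⊓ W ≤ W)).op
          (φ.app W le_rfl (F.res inf_le_left hUW s)) :=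
      φ.naturality le_rfl (inf_le_right : U ⊓ W ≤ W) _
    exact h3.symm.trans (h1.trans h2)

end OModuleOn


/-- Restriction of sections of the structure sheaf, as a ring homomorphism. -/
def rs (O : (Opens α)ᵒᵖ ⥤ CommRingCat.{u}) {A B : Opens α} (h : B ≤ A) :
    O.obj (op A) →+* O.obj (op B) := (O.map (homOfLE h).op).hom

lemma rs_rs (O : (Opens α)ᵒᵖ ⥤ CommRingCat.{u}) {A B C : Opens α}
    (h₁ : B ≤ A) (h₂ : C ≤ B) (r : O.obj (op A)) :
    rs O h₂ (rs O h₁ r) = rs O (h₂.trans h₁) r := map_map_apply O h₁ h₂ r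

lemma rs_self (O : (Opens α)ᵒᵖ ⥤ CommRingCat.{u}) {A : Opens α} (h : A ≤ A)
    (r : O.obj (op A)) : rs O h r = r := map_id_apply O h r

namespace OModuleOn
variable {O : (Opens α)ᵒᵖ ⥤ CommRingCat.{u}} {U : Opens α}

lemma res_smul' (F : OModuleOn O U) {W W' : Opens α} (hW : W ≤ U) (h : W' ≤ W)
    (r : O.obj (op W)) (s : F.sec W hW) :
    F.res hW h (r • s) = rs O h r • F.res hW h s := F.res_smul hW h r s

lemma res_sum (F : OModuleOn O U) {W W' : Opens α} (hW : W ≤ U) (h : W' ≤ W) {ι : Type*}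
    (S : Finset ι) (f : ι → F.sec W hW) :
    F.res hW h (∑ i ∈ S, f i) = ∑ i ∈ S, F.res hW h (f i) := map_sum (F.resAddHom hW h) f S

lemma res_sub (F : OModuleOn O U) {W W' : Opens α} (hW : W ≤ U) (h : W' ≤ W)
    (s t : F.sec W hW) : F.res hW h (s - t) = F.res hW h s - F.res hW h t :=
  map_sub (F.resAddHom hW h) s t

/-- Evaluation of a functional at a section. -/
def ev (F : OModuleOn O U) {W : Opens α} {hW : W ≤ U} (φ : F.dual.sec W hW) {W' : Opens α}
    (h : W' ≤ W) (s : F.sec W' (h.trans hW)) : O.obj (op W') :=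
  OModuleHom.app φ W' h s

section
variable (F : OModuleOn O U) {W : Opens α} {hW : W ≤ U}

lemma ev_add (φ : F.dual.sec W hW) {W' : Opens α} (h : W' ≤ W) (s t : F.sec W' (h.trans hW)) :
    F.ev φ h (s + t) = F.ev φ h s + F.ev φ h t := φ.app_add W' h s t

lemma ev_smul (φ : F.dual.sec W hW) {W' : Opens α} (h : W' ≤ W) (r : O.obj (op W'))
    (s : F.sec W' (h.trans hW)) :
    F.ev φ h (r • s) = r * F.ev φ h s := φ.app_smul W' h r s

lemma ev_zero (φ : F.dual.sec W hW) {W' : Opens α} (h : W' ≤ W) :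
    F.ev φ h (0 : F.sec W' (h.trans hW)) = 0 := φ.app_zero W' h

lemma ev_res (φ : F.dual.sec W hW) {W' W'' : Opens α} (h : W' ≤ W) (h' : W'' ≤ W')
    (s : F.sec W' (h.trans hW)) :
    F.ev φ (h'.trans h) (F.res (h.trans hW) h' s) = rs O h' (F.ev φ h s) :=
  φ.naturality h h' s

lemma ev_sum (φ : F.dual.sec W hW) {W' : Opens α} (h : W' ≤ W) {ι : Type*} (S : Finset ι)
    (f : ι → F.sec W' (h.trans hW)) :
    F.ev φ h (∑ i ∈ S, f i) = ∑ i ∈ S, F.ev φ h (f i) :=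
  map_sum (AddMonoidHom.mk' (F.ev φ h) (F.ev_add φ h)) f S

lemma dual_ext {φ ψ : F.dual.sec W hW} (H : ∀ (W' : Opens α) (h : W' ≤ W)
    (s : F.sec W' (h.trans hW)), F.ev φ h s = F.ev ψ h s) : φ = ψ := by
  apply OModuleHom.ext
  funext W' h s
  exact H W' h s

lemma ev_dual_res (φ : F.dual.sec W hW) {W' W'' : Opens α} (h : W' ≤ W) (h' : W'' ≤ W')
    (s : F.sec W'' (h'.trans (h.trans hW))) :
    F.ev (F.dual.res hW h φ) h' s = F.ev φ (h'.trans h) s := rfl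

lemma add_ev (φ ψ : F.dual.sec W hW) {W' : Opens α} (h : W' ≤ W) (s : F.sec W' (h.trans hW)) :
    F.ev (φ + ψ) h s = F.ev φ h s + F.ev ψ h s := rfl

lemma zero_ev {W' : Opens α} (h : W' ≤ W) (s : F.sec W' (h.trans hW)) :
    F.ev (0 : F.dual.sec W hW) h s = 0 := rfl

lemma smul_ev (r : O.obj (op W)) (φ : F.dual.sec W hW) {W' : Opens α} (h : W' ≤ W)
    (s : F.sec W' (h.trans hW)) :
    F.ev (r • φ) h s = rs O h r * F.ev φ h s := rfl

lemma sum_ev {ι : Type*} (S : Finset ι) (f : ι → F.dual.sec W hW) {W' : Opens α} (h : W' ≤ W)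
    (s : F.sec W' (h.trans hW)) :
    F.ev (∑ i ∈ S, f i) h s = ∑ i ∈ S, F.ev (f i) h s :=
  map_sum (AddMonoidHom.mk' (fun φ : F.dual.sec W hW => F.ev φ h s)
    (fun φ ψ => F.add_ev φ ψ h s)) f S

/-- Constructor for functionals. -/
def mkDual (W : Opens α) (hW : W ≤ U)
    (e : ∀ (W' : Opens α) (h : W' ≤ W), F.sec W' (h.trans hW) → O.obj (op W'))
    (hadd : ∀ W' h s t, e W' h (s + t) = e W' h s + e W' h t)
    (hsmul : ∀ W' h r s, e W' h (r • s) = r * e W' h s)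
    (hres : ∀ (W' W'' : Opens α) (h : W' ≤ W) (h' : W'' ≤ W') (s : F.sec W' (h.trans hW)),
      e W'' (h'.trans h) (F.res (h.trans hW) h' s) = rs O h' (e W' h s)) :
    F.dual.sec W hW :=
  OModuleHom.mk (F := F.restrictTo hW) (G := (unit O U).restrictTo hW) e hadd hsmul
    (fun h h' s => hres _ _ h h' s)

lemma ev_mkDual (e hadd hsmul hres) {W' : Opens α} (h : W' ≤ W) (s : F.sec W' (h.trans hW)) :
    F.ev (F.mkDual W hW e hadd hsmul hres) h s = e W' h s := rfl

/-- Sections are separated by functionals. -/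
def Sep (F : OModuleOn O U) : Prop := ∀ (W : Opens α) (hW : W ≤ U) (s : F.sec W hW),
  (∀ (W' : Opens α) (h : W' ≤ W) (φ : F.dual.sec W' (h.trans hW)),
    F.ev φ le_rfl (F.res hW h s) = 0) → s = 0

lemma IsReflexive.sep {F : OModuleOn O U} (hF : F.IsReflexive) : F.Sep := by
  intro W hW s hs
  apply (hF W hW).1
  apply OModuleHom.ext
  funext W' h φ
  refine (hs W' h φ).trans ?_
  refine Eq.trans ?_ (congrArg (F.ev φ le_rfl) (F.res_zero hW h)).symm
  exact (F.ev_zero φ le_rfl).symm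

end

end OModuleOn

/-- Torsion-freeness in the form needed below. -/
def OModuleOn.TF {X : Scheme.{u}} {U : X.Opens} (G : OModuleOn X.presheaf U) : Prop :=
  ∀ (W : X.Opens) (hW : W ≤ U) (E : X.Opens) (hE : E ≤ W), IntgOn X W → E ≠ ⊥ →
    ∀ s : G.sec W hW, G.res hW hE s = 0 → s = 0

lemma IntgOn.eq {X : Scheme.{u}} {V : X.Opens} (hI : IntgOn X V) {W D : X.Opens} (hW : W ≤ V)
    (hD : D ≤ V) (hne : D ≠ ⊥) {E : X.Opens} (hE : E ≤ W) (hEWD : W ⊓ D ≤ E)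
    {a b : X.presheaf.obj (op W)} (hab : rs X.presheaf hE a = rs X.presheaf hE b) : a = b := by
  rw [← sub_eq_zero]
  apply hI W D hW hD hne
  show rs X.presheaf inf_le_left (a - b) = 0
  rw [← rs_rs X.presheaf hE hEWD, map_sub, hab, sub_self, map_zero]

lemma OModuleOn.Sep.tf {X : Scheme.{u}} {U : X.Opens} {F : OModuleOn X.presheaf U}
    (hF : F.Sep) : F.TF := by
  intro W hW E hE hI hne s hs
  apply hF W hW s
  intro W' h φ
  apply hI.eq h hE hne (inf_le_left : W' ⊓ E ≤ W') le_rfl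
  rw [← F.ev_res, map_zero, F.res_comp, ← F.res_comp hW hE inf_le_right, hs, F.res_zero, F.ev_zero]

lemma eq_of_locally' {X : Scheme.{u}} (W : X.Opens) (a b : X.presheaf.obj (op W))
    (h : ∀ y ∈ W, ∃ (T : X.Opens) (hT : T ≤ W), y ∈ T ∧
      rs X.presheaf hT a = rs X.presheaf hT b) : a = b := eq_of_locally W a b h

lemma glue_lift {X : Scheme.{u}} {V : X.Opens} (hI : IntgOn X V) {D : X.Opens} (hD : D ≤ V)
    (hne : D ≠ ⊥) {W : X.Opens} (hW : W ≤ V) (c : X.presheaf.obj (op (W ⊓ D)))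
    (h : ∀ z ∈ W, ∃ (T : X.Opens) (hT : T ≤ W), z ∈ T ∧ ∃ a : X.presheaf.obj (op T),
      rs X.presheaf (inf_le_left : T ⊓ D ≤ T) a = rs X.presheaf (inf_le_inf_right D hT) c) :
    ∃ a : X.presheaf.obj (op W), rs X.presheaf (inf_le_left : W ⊓ D ≤ W) a = c := by
  choose T hT hz a ha using h
  obtain ⟨b, hb⟩ := isSheaf_unit_glue W (fun y => T y.1 y.2) (fun y => hT _ _) (fun y => hz _ _)
    (fun y => a _ _) (by
      intro y z
      apply hI.eq (inf_le_left.trans ((hT _ _).trans hW)) hD hne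
        (inf_le_left : (T y.1 y.2 ⊓ T z.1 z.2) ⊓ D ≤ _) le_rfl
      show rs X.presheaf _ (rs X.presheaf _ _) = rs X.presheaf _ (rs X.presheaf _ _)
      rw [rs_rs, rs_rs]
      rw [← rs_rs X.presheaf (inf_le_left : T y.1 y.2 ⊓ D ≤ T y.1 y.2)
        (inf_le_inf_right D inf_le_left), ha]
      rw [← rs_rs X.presheaf (inf_le_left : T z.1 z.2 ⊓ D ≤ T z.1 z.2)
        (inf_le_inf_right D inf_le_right), ha]
      rw [rs_rs, rs_rs])
  refine ⟨b, eq_of_locally' _ _ _ fun y hy => ⟨T y hy.1 ⊓ D, inf_le_inf_right D (hT _ _),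
    ⟨hz _ _, hy.2⟩, ?_⟩⟩
  rw [← ha, rs_rs]
  have : rs X.presheaf (hT y hy.1) b = a y hy.1 := hb ⟨y, hy.1⟩
  rw [← this, rs_rs]

lemma basicOpen_rs {X : Scheme.{u}} {V W : X.Opens} (h : W ≤ V) (g : Γ(X, V)) :
    X.basicOpen (rs X.presheaf h g) = W ⊓ X.basicOpen g := X.basicOpen_res g (homOfLE h).op


lemma exists_pow_mul_lift' {X : Scheme.{u}} {V : X.Opens} (hV : IsAffineOpen V) (g : Γ(X, V))
    (D : X.Opens) (hD : D = X.basicOpen g) (hDV : D ≤ V) (a : X.presheaf.obj (op D)) :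
    ∃ (k : ℕ), ∀ k' ≥ k, ∃ (b : X.presheaf.obj (op V)), rs X.presheaf hDV b =
      (rs X.presheaf hDV g) ^ k' * a := by
  obtain ⟨k, b, hb⟩ := exists_pow_mul_lift hV g D hD hDV a
  refine ⟨k, fun k' hk => ⟨g ^ (k' - k) * b, ?_⟩⟩
  have hb' : rs X.presheaf hDV b = (rs X.presheaf hDV g) ^ k * a := hb
  have := pow_sub_mul_pow (rs X.presheaf hDV g) hk
  rw [map_mul, map_pow, hb', ← mul_assoc, this]

lemma exists_pow_mul_lift_fin {X : Scheme.{u}} {V : X.Opens} (hV : IsAffineOpen V) (g : Γ(X, V))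
    (D : X.Opens) (hD : D = X.basicOpen g) (hDV : D ≤ V) {n : ℕ}
    (a : Fin n → X.presheaf.obj (op D)) :
    ∃ (k : ℕ), ∀ k' ≥ k, ∃ (b : Fin n → X.presheaf.obj (op V)), ∀ i, rs X.presheaf hDV (b i) =
      (rs X.presheaf hDV g) ^ k' * a i := by
  choose k hk using fun i => exists_pow_mul_lift' hV g D hD hDV (a i)
  refine ⟨Finset.univ.sup k, fun k' hk' => ?_⟩
  choose b hb using fun i => hk i k' ((Finset.le_sup (Finset.mem_univ i)).trans hk')
  exact ⟨b, hb⟩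

/-- `g ^ k • φ` takes regular values on sections of `H` over `W`. -/
def LiftsOn {X : Scheme.{u}} {U : X.Opens} (H : OModuleOn X.presheaf U) {V D : X.Opens}
    (hVU : V ≤ U) (hDV : D ≤ V) (g : Γ(X, V)) (φ : H.dual.sec D (hDV.trans hVU)) (k : ℕ)
    (W : X.Opens) : Prop :=
  ∀ (hW : W ≤ V) (t : H.sec W (hW.trans hVU)), ∃ a : X.presheaf.obj (op W),
    rs X.presheaf (inf_le_left : W ⊓ D ≤ W) a =
      rs X.presheaf (inf_le_left.trans hW : W ⊓ D ≤ V) g ^ k *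
        H.ev φ (inf_le_right : W ⊓ D ≤ D) (H.res _ (inf_le_left : W ⊓ D ≤ W) t)

lemma liftsOn_of_locally {X : Scheme.{u}} {U : X.Opens} (H : OModuleOn X.presheaf U)
    {V D : X.Opens} (hVU : V ≤ U) (hDV : D ≤ V) (hI : IntgOn X V) (hne : D ≠ ⊥)
    (g : Γ(X, V)) (φ : H.dual.sec D (hDV.trans hVU)) (k : ℕ)
    (W : X.Opens) (hW : W ≤ V) (t : H.sec W (hW.trans hVU))
    (hloc : ∀ z ∈ W, ∃ (T : X.Opens) (hT : T ≤ W), z ∈ T ∧ ∃ a : X.presheaf.obj (op T),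
      rs X.presheaf (inf_le_left : T ⊓ D ≤ T) a =
      rs X.presheaf (inf_le_left.trans (hT.trans hW) : T ⊓ D ≤ V) g ^ k *
        H.ev φ (inf_le_right : T ⊓ D ≤ D) (H.res _ (inf_le_left.trans hT : T ⊓ D ≤ W) t)) :
    ∃ a : X.presheaf.obj (op W),
    rs X.presheaf (inf_le_left : W ⊓ D ≤ W) a =
      rs X.presheaf (inf_le_left.trans hW : W ⊓ D ≤ V) g ^ k *
        H.ev φ (inf_le_right : W ⊓ D ≤ D) (H.res _ (inf_le_left : W ⊓ D ≤ W) t) := by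
  apply glue_lift hI hDV hne hW
  intro z hz
  obtain ⟨T, hT, hzT, a, ha⟩ := hloc z hz
  refine ⟨T, hT, hzT, a, ha.trans ?_⟩
  rw [map_mul, map_pow, rs_rs, ← H.ev_res, H.res_comp]

lemma exists_liftsOn_nbhd {X : Scheme.{u}} {U : X.Opens} (H : OModuleOn X.presheaf U)
    (hH : H.IsFiniteType)
    {V D : X.Opens} (hVU : V ≤ U) (hDV : D ≤ V) (hI : IntgOn X V) (hne : D ≠ ⊥)
    (g : Γ(X, V)) (hD : D = X.basicOpen g) (φ : H.dual.sec D (hDV.trans hVU))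
    (y : X) (hy : y ∈ V) : ∃ (A : X.Opens) (k : ℕ), y ∈ A ∧
      ∀ k' ≥ k, ∀ W ≤ A, LiftsOn H hVU hDV g φ k' W := by
  obtain ⟨W₁, hW₁, hyW₁, n, s, hs⟩ := hH y (hVU hy)
  obtain ⟨_, ⟨A, hA, rfl⟩, hyA, hAW⟩ := X.isBasis_affineOpens.exists_subset_of_mem_open
    (show y ∈ W₁ ⊓ V from ⟨hyW₁, hy⟩) (W₁ ⊓ V).isOpen
  have hAW₁ : A ≤ W₁ := fun z hz => (hAW hz).1
  have hAV : A ≤ V := fun z hz => (hAW hz).2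
  have hA' : IsAffineOpen A := hA
  obtain ⟨k, hk⟩ := exists_pow_mul_lift_fin hA' (rs X.presheaf hAV g) (A ⊓ D)
    (by rw [basicOpen_rs, hD]) inf_le_left
    (fun i => H.ev φ (inf_le_right : A ⊓ D ≤ D)
      (H.res hW₁ ((inf_le_left : A ⊓ D ≤ A).trans hAW₁) (s i)))
  refine ⟨A, k, hyA, fun k' hk' W hWA hW t => ?_⟩
  obtain ⟨b, hb⟩ := hk k' hk'
  refine liftsOn_of_locally H hVU hDV hI hne g φ _ W hW t ?_
  intro z hz
  obtain ⟨T, hT, hzT, a, ha⟩ := hs W (hWA.trans hAW₁) t z hz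
  refine ⟨T, hT, hzT, ∑ i, a i * rs X.presheaf (hT.trans hWA) (b i), ?_⟩
  rw [← H.res_comp _ hT inf_le_left, ha, H.res_sum, H.ev_sum, map_sum, Finset.mul_sum]
  refine Finset.sum_congr rfl fun i _ => ?_
  have h1 : T ⊓ D ≤ A ⊓ D := inf_le_inf_right D (hT.trans hWA)
  have hb1 := congrArg (rs X.presheaf h1) (hb i)
  rw [rs_rs, map_mul, map_pow, rs_rs, rs_rs, ← H.ev_res, H.res_comp] at hb1
  rw [map_mul, rs_rs, hb1, H.res_smul', H.ev_smul, H.res_comp]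
  ring

lemma exists_liftsOn {X : Scheme.{u}} {U : X.Opens} (H : OModuleOn X.presheaf U)
    (hH : H.IsFiniteType)
    {V D : X.Opens} (hVU : V ≤ U) (hDV : D ≤ V) (hI : IntgOn X V) (hne : D ≠ ⊥)
    (hc : IsCompact (V : Set X))
    (g : Γ(X, V)) (hD : D = X.basicOpen g) (φ : H.dual.sec D (hDV.trans hVU)) :
    ∃ k : ℕ, ∀ W, LiftsOn H hVU hDV g φ k W := by
  have key : ∃ k : ℕ, ∀ k' ≥ k, ∀ y ∈ (V : Set X), ∃ A : X.Opens, y ∈ A ∧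
      ∀ W ≤ A, LiftsOn H hVU hDV g φ k' W := by
    refine hc.induction_on (p := fun S => ∃ k : ℕ, ∀ k' ≥ k, ∀ y ∈ S, ∃ A : X.Opens, y ∈ A ∧
      ∀ W ≤ A, LiftsOn H hVU hDV g φ k' W) ?_ ?_ ?_ ?_
    · exact ⟨0, fun _ _ y hy => hy.elim⟩
    · rintro S S' hS ⟨k, hk⟩
      exact ⟨k, fun k' hk' y hy => hk k' hk' y (hS hy)⟩
    · rintro S S' ⟨k, hk⟩ ⟨l, hl⟩
      refine ⟨max k l, fun k' hk' y hy => ?_⟩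
      rcases hy with hy | hy
      · exact hk k' ((le_max_left _ _).trans hk') y hy
      · exact hl k' ((le_max_right _ _).trans hk') y hy
    · intro y hy
      obtain ⟨A, k, hyA, hA⟩ := exists_liftsOn_nbhd H hH hVU hDV hI hne g hD φ y hy
      exact ⟨A, mem_nhdsWithin_of_mem_nhds (A.isOpen.mem_nhds hyA), k,
        fun k' hk' z hz => ⟨A, hz, hA k' hk'⟩⟩
  obtain ⟨k, hk⟩ := key
  refine ⟨k, fun W hW t => ?_⟩
  refine liftsOn_of_locally H hVU hDV hI hne g φ _ W hW t ?_
  intro z hz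
  obtain ⟨A, hzA, hA⟩ := hk k le_rfl z (hW hz)
  obtain ⟨a, ha⟩ := hA (A ⊓ W) inf_le_left (inf_le_right.trans hW) (H.res _ inf_le_right t)
  refine ⟨A ⊓ W, inf_le_right, ⟨hzA, hz⟩, a, ?_⟩
  rw [ha, H.res_comp]

/-- Functionals on a finite type module extend from a basic open after multiplying by a power. -/
lemma ext_dual {X : Scheme.{u}} {U : X.Opens} (H : OModuleOn X.presheaf U)
    (hH : H.IsFiniteType)
    {V D : X.Opens} (hVU : V ≤ U) (hDV : D ≤ V) (hI : IntgOn X V) (hne : D ≠ ⊥)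
    (hc : IsCompact (V : Set X))
    (g : Γ(X, V)) (hD : D = X.basicOpen g) (φ : H.dual.sec D (hDV.trans hVU)) :
    ∃ (k : ℕ) (ψ : H.dual.sec V hVU),
      H.dual.res hVU hDV ψ = rs X.presheaf hDV g ^ k • φ := by
  obtain ⟨k, hk⟩ := exists_liftsOn H hH hVU hDV hI hne hc g hD φ
  choose e he using hk
  have huniq : ∀ (W : X.Opens) (hW : W ≤ V) (a b : X.presheaf.obj (op W)),
      rs X.presheaf (inf_le_left : W ⊓ D ≤ W) a = rs X.presheaf (inf_le_left : W ⊓ D ≤ W) b →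
      a = b := fun W hW a b hab => hI.eq hW hDV hne inf_le_left le_rfl hab
  refine ⟨k, H.mkDual V hVU e ?_ ?_ ?_, ?_⟩
  · intro W hW s t
    apply huniq W hW
    rw [map_add, he, he, he, H.res_add, H.ev_add, mul_add]
  · intro W hW r s
    apply huniq W hW
    rw [map_mul, he, he, H.res_smul', H.ev_smul]
    ring
  · intro W W' hW h s
    apply huniq W' (h.trans hW)
    rw [he, rs_rs, ← rs_rs X.presheaf (inf_le_left : W ⊓ D ≤ W) (inf_le_inf_right D h), he,
      map_mul, map_pow, rs_rs, ← H.ev_res, H.res_comp, H.res_comp]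
  · apply H.dual_ext
    intro W h s
    rw [H.ev_dual_res, H.ev_mkDual, H.smul_ev, map_pow, rs_rs]
    apply huniq W (h.trans hDV)
    rw [he, map_mul, map_pow, rs_rs, ← H.ev_res]


lemma isUnit_rs_basicOpen {X : Scheme.{u}} {V D : X.Opens} (g : Γ(X, V)) (hD : D ≤ X.basicOpen g)
    (hDV : D ≤ V) : IsUnit (rs X.presheaf hDV g) := by
  have h1 : IsUnit (rs X.presheaf (X.basicOpen_le g) g) := isUnit_res_basicOpen g
  have h2 := h1.map (rs X.presheaf hD)
  rwa [rs_rs] at h2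

lemma generates_of_ext {X : Scheme.{u}} {U : X.Opens} (G : OModuleOn X.presheaf U)
    {V : X.Opens} (hV : IsAffineOpen V) (hVU : V ≤ U)
    (hext : ∀ (g : Γ(X, V)) (D : X.Opens) (hD : D = X.basicOpen g) (hDV : D ≤ V) (hne : D ≠ ⊥)
      (t : G.sec D (hDV.trans hVU)), ∃ (k : ℕ) (t' : G.sec V hVU),
        G.res hVU hDV t' = rs X.presheaf hDV g ^ k • t)
    (hfin : Module.Finite Γ(X, V) (G.sec V hVU)) :
    ∃ (n : ℕ) (s : Fin n → G.sec V hVU), G.Generates hVU s := by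
  obtain ⟨n, s, hs⟩ := Module.Finite.exists_fin (R := Γ(X, V)) (M := G.sec V hVU)
  refine ⟨n, s, fun W hW t x hx => ?_⟩
  obtain ⟨g, hgW, hxg⟩ := hV.exists_basicOpen_le ⟨x, hx⟩ (hW hx)
  have hDV : X.basicOpen g ≤ V := X.basicOpen_le g
  have hne : X.basicOpen g ≠ ⊥ := by
    rw [Opens.ne_bot_iff_nonempty]; exact ⟨x, hxg⟩
  obtain ⟨k, t', ht'⟩ := hext g _ rfl hDV hne (G.res _ hgW t)
  have hmem : t' ∈ Submodule.span Γ(X, V) (Set.range s) := by rw [hs]; trivial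
  obtain ⟨c, hc⟩ := (Submodule.mem_span_range_iff_exists_fun _).mp hmem
  obtain ⟨v, hv⟩ := ((isUnit_rs_basicOpen g le_rfl hDV).pow k).exists_left_inv
  refine ⟨X.basicOpen g, hgW, hxg, fun i => v * rs X.presheaf hDV (c i), ?_⟩
  have h1 : G.res _ hgW t = v • G.res hVU hDV t' := by
    rw [ht', smul_smul, hv, one_smul]
  rw [h1, ← hc, G.res_sum, Finset.smul_sum]
  refine Finset.sum_congr rfl fun i _ => ?_
  rw [G.res_smul', smul_smul]

lemma relations_of_tf {X : Scheme.{u}} [IsLocallyNoetherian X] (hX : IsNormalScheme X)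
    {U : X.Opens} (G : OModuleOn X.presheaf U) (hG : G.TF) (W : X.Opens) (hW : W ≤ U) (n : ℕ)
    (s : Fin n → G.sec W hW) : G.RelationsFiniteType hW s := by
  intro x hx
  obtain ⟨V, hxV, hVW, hV, hd, hN, hI⟩ := exists_good_nbhd hX x W hx
  let L : (Fin n → Γ(X, V)) →ₗ[Γ(X, V)] G.sec V (hVW.trans hW) :=
    Fintype.linearCombination Γ(X, V) (fun i => G.res hW hVW (s i))
  have hL : ∀ a, L a = ∑ i, a i • G.res hW hVW (s i) := fun a =>
    Fintype.linearCombination_apply _ _ _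
  have hfg : (LinearMap.ker L).FG := IsNoetherian.noetherian _
  obtain ⟨m, t, ht⟩ := Submodule.fg_iff_exists_fin_generating_family.mp hfg
  refine ⟨V, hVW, hxV, m, t, fun j => ?_, ?_⟩
  · have : t j ∈ LinearMap.ker L := by
      rw [← ht]; exact Submodule.subset_span ⟨j, rfl⟩
    exact (hL _).symm.trans this
  · intro V' h' a ha y hy
    obtain ⟨g, hgV', hyg⟩ := hV.exists_basicOpen_le ⟨y, hy⟩ (h' hy)
    have hDV : X.basicOpen g ≤ V := X.basicOpen_le g
    have hne : X.basicOpen g ≠ ⊥ := by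
      rw [Opens.ne_bot_iff_nonempty]; exact ⟨y, hyg⟩
    obtain ⟨k, hk⟩ := exists_pow_mul_lift_fin hV g _ rfl hDV
      (fun i => rs X.presheaf hgV' (a i))
    obtain ⟨b, hb⟩ := hk k le_rfl
    have hbK : b ∈ LinearMap.ker L := by
      rw [LinearMap.mem_ker, hL]
      apply hG V _ _ hDV hI hne
      rw [G.res_sum]
      have h1 := congrArg (G.res _ hgV') ha
      rw [G.res_zero, G.res_sum] at h1
      have h2 : (∑ i, G.res _ hDV (b i • G.res hW hVW (s i))) =
          rs X.presheaf hDV g ^ k • ∑ i, G.res _ hgV' (a i • G.res hW (h'.trans hVW) (s i)) := by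
        rw [Finset.smul_sum]
        refine Finset.sum_congr rfl fun i _ => ?_
        rw [G.res_smul', hb, G.res_smul', smul_smul, G.res_comp, G.res_comp]
      rw [h2, h1, smul_zero]
    rw [← ht] at hbK
    obtain ⟨c, hc⟩ := (Submodule.mem_span_range_iff_exists_fun _).mp hbK
    obtain ⟨v, hv⟩ := ((isUnit_rs_basicOpen g le_rfl hDV).pow k).exists_left_inv
    refine ⟨X.basicOpen g, hgV', hyg, fun j => v * rs X.presheaf hDV (c j), fun i => ?_⟩
    have h1 : rs X.presheaf hgV' (a i) = v * rs X.presheaf hDV (b i) := by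
      rw [hb, ← mul_assoc, hv, one_mul]
    refine h1.trans ?_
    have h2 : b i = ∑ j, c j * t j i := by
      rw [← hc, Finset.sum_apply]; rfl
    rw [h2, map_sum, Finset.mul_sum]
    refine Finset.sum_congr rfl fun j _ => ?_
    rw [map_mul, ← mul_assoc]
    rfl

lemma dual_isFiniteType {X : Scheme.{u}} [IsLocallyNoetherian X] (hX : IsNormalScheme X)
    {U : X.Opens} (F : OModuleOn X.presheaf U) (hF : F.IsFiniteType) : F.dual.IsFiniteType := by
  intro x hx
  obtain ⟨W, hW, hxW, n, s, hs⟩ := hF x hx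
  obtain ⟨V, hxV, hVW, hV, hd, hN, hI⟩ := exists_good_nbhd hX x W hxW
  refine ⟨V, hVW.trans hW, hxV, ?_⟩
  apply generates_of_ext F.dual hV (hVW.trans hW)
  · intro g D hD hDV hne t
    exact ext_dual F hF (hVW.trans hW) hDV hI hne hV.isCompact g hD t
  · let L : F.dual.sec V (hVW.trans hW) →ₗ[Γ(X, V)] (Fin n → Γ(X, V)) :=
      { toFun := fun φ i => F.ev φ le_rfl (F.res hW hVW (s i))
        map_add' := fun φ ψ => by
          funext i
          exact F.add_ev φ ψ le_rfl _
        map_smul' := fun r φ => by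
          funext i
          refine (F.smul_ev r φ le_rfl _).trans ?_
          rw [rs_self]
          rfl }
    refine Module.Finite.of_injective L ?_
    intro φ ψ hφψ
    apply F.dual_ext
    intro W' h t
    apply eq_of_locally'
    intro y hy
    obtain ⟨T, hT, hyT, a, ha⟩ := hs W' (h.trans hVW) t y hy
    refine ⟨T, hT, hyT, ?_⟩
    rw [← F.ev_res, ← F.ev_res, ha, F.ev_sum, F.ev_sum]
    refine Finset.sum_congr rfl fun i _ => ?_
    rw [F.ev_smul, F.ev_smul]
    congr 1
    have h1 : F.ev φ le_rfl (F.res hW hVW (s i)) = F.ev ψ le_rfl (F.res hW hVW (s i)) :=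
      congrFun hφψ i
    have h2 := congrArg (rs X.presheaf (hT.trans h)) h1
    rw [← F.ev_res, ← F.ev_res, F.res_comp] at h2
    exact h2

lemma ext_reflexive {X : Scheme.{u}} {U : X.Opens} (F : OModuleOn X.presheaf U)
    (hF : F.IsReflexive) (hdual : F.dual.IsFiniteType)
    {V D : X.Opens} (hVU : V ≤ U) (hDV : D ≤ V) (hI : IntgOn X V) (hne : D ≠ ⊥)
    (hc : IsCompact (V : Set X))
    (g : Γ(X, V)) (hD : D = X.basicOpen g) (s : F.sec D (hDV.trans hVU)) :
    ∃ (k : ℕ) (s' : F.sec V hVU), F.res hVU hDV s' = rs X.presheaf hDV g ^ k • s := by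
  obtain ⟨k, Ψ, hΨ⟩ := ext_dual F.dual hdual hVU hDV hI hne hc g hD
    (F.evalHom.app D (hDV.trans hVU) s)
  obtain ⟨s', hs'⟩ := (hF V hVU).2 Ψ
  refine ⟨k, s', (hF D (hDV.trans hVU)).1 ?_⟩
  refine (F.evalHom.naturality hVU hDV s').trans ?_
  refine (congrArg (F.bidual.res hVU hDV) hs').trans ?_
  exact hΨ.trans (F.evalHom.app_smul D (hDV.trans hVU) _ s).symm


lemma inf_ne_bot' {X : Scheme.{u}} [IsLocallyNoetherian X] (hX : IsNormalScheme X) {U : X.Opens}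
    (hZ : hasEverywhereCodimAtLeastTwo ((U : Set X)ᶜ)) {E : X.Opens} (hE : E ≠ ⊥) :
    U ⊓ E ≠ ⊥ := by
  obtain ⟨y, hy⟩ := (Opens.ne_bot_iff_nonempty _).mp hE
  obtain ⟨V, hyV, hVE, hV, hd, hN, hI⟩ := exists_good_nbhd hX y E hy
  have := inf_ne_bot hZ hV
  rw [Opens.ne_bot_iff_nonempty] at this ⊢
  obtain ⟨z, hz⟩ := this
  exact ⟨z, hz.1, hVE hz.2⟩

lemma isCompact_inf {X : Scheme.{u}} [IsLocallyNoetherian X] {U V : X.Opens}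
    (hV : IsAffineOpen V) : IsCompact ((U ⊓ V : X.Opens) : Set X) := by
  have h0 : IsNoetherianRing Γ(X, V) := IsLocallyNoetherian.component_noetherian ⟨V, hV⟩
  have h1 : NoetherianSpace V := noetherianSpace_of_isAffineOpen V hV
  have h2 : NoetherianSpace (V : Set X) := h1
  rw [noetherianSpace_set_iff] at h2
  exact h2 _ (fun x hx => hx.2)

lemma pushforward_tf {X : Scheme.{u}} [IsLocallyNoetherian X] (hX : IsNormalScheme X)
    {U : X.Opens} (hZ : hasEverywhereCodimAtLeastTwo ((U : Set X)ᶜ))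
    (F : OModuleOn X.presheaf U) (hF : F.TF) : F.pushforward.TF := by
  intro W hW E hE hI hne s hs
  exact hF (U ⊓ W) inf_le_left (U ⊓ E) (inf_le_inf_left U hE) (intgOn_mono inf_le_right hI)
    (inf_ne_bot' hX hZ hne) s hs

lemma unit_sep {X : Scheme.{u}} [IsLocallyNoetherian X] (hX : IsNormalScheme X)
    {U : X.Opens} (hZ : hasEverywhereCodimAtLeastTwo ((U : Set X)ᶜ))
    (W : X.Opens) (a : X.presheaf.obj (op W))
    (ha : X.presheaf.map (homOfLE (inf_le_right : U ⊓ W ≤ W)).op a = 0) : a = 0 := by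
  have ha' : rs X.presheaf (inf_le_right : U ⊓ W ≤ W) a = 0 := ha
  apply eq_of_locally'
  intro y hy
  obtain ⟨V, hyV, hVW, hV, hd, hN, hI⟩ := exists_good_nbhd hX y W hy
  refine ⟨V, hVW, hyV, ?_⟩
  apply hI.eq le_rfl (inf_le_right : U ⊓ V ≤ V) (inf_ne_bot hZ hV) inf_le_right inf_le_right
  rw [rs_rs, rs_rs, ← rs_rs X.presheaf (inf_le_right : U ⊓ W ≤ W) (inf_le_inf_left U hVW), ha',
    map_zero, map_zero]

/-- There are finitely many functionals on `U ⊓ V` separating sections of `F`. -/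
lemma exists_functionals {X : Scheme.{u}} [IsLocallyNoetherian X]
    {U : X.Opens} (hZ : hasEverywhereCodimAtLeastTwo ((U : Set X)ᶜ))
    (F : OModuleOn X.presheaf U) (hF : F.Sep) (hfin : F.IsFiniteType)
    (hdual : F.dual.IsFiniteType) {V : X.Opens} (hV : IsAffineOpen V) [IsDomain Γ(X, V)]
    (hI : IntgOn X V) : ∃ (m : ℕ) (ψ : Fin m → F.dual.sec (U ⊓ V) inf_le_left),
      ∀ s : F.sec (U ⊓ V) inf_le_left, (∀ j, F.ev (ψ j) le_rfl s = 0) → s = 0 := by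
  obtain ⟨y, hy⟩ := (Opens.ne_bot_iff_nonempty _).mp (inf_ne_bot hZ hV)
  obtain ⟨W, hW, hyW, m, φ, hφ⟩ := hdual y hy.1
  obtain ⟨h, hhW, hyh⟩ := hV.exists_basicOpen_le (V := W ⊓ U) ⟨y, ⟨hyW, hy.1⟩⟩ hy.2
  set D := X.basicOpen h with hDdef
  have hDV : D ≤ V := X.basicOpen_le h
  have hDUV : D ≤ U ⊓ V := le_inf (hhW.trans inf_le_right) hDV
  have hDW : D ≤ W := hhW.trans inf_le_left
  have hne : D ≠ ⊥ := by rw [Opens.ne_bot_iff_nonempty]; exact ⟨y, hyh⟩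
  have hI' : IntgOn X (U ⊓ V) := intgOn_mono inf_le_right hI
  have hD' : D = X.basicOpen (rs X.presheaf (inf_le_right : U ⊓ V ≤ V) h) := by
    rw [basicOpen_rs, ← hDdef]
    exact (inf_eq_right.mpr hDUV).symm
  choose k ψ hψ using fun j => ext_dual F hfin (inf_le_left : U ⊓ V ≤ U) hDUV hI' hne
    (isCompact_inf hV) (rs X.presheaf (inf_le_right : U ⊓ V ≤ V) h) hD' (F.dual.res hW hDW (φ j))
  refine ⟨m, ψ, fun s hs => ?_⟩
  apply hF.tf (U ⊓ V) inf_le_left D hDUV hI' hne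
  apply hF
  intro W' hW' χ
  apply eq_of_locally'
  intro z hz
  obtain ⟨T, hT, hzT, a, ha⟩ := hφ W' (hW'.trans hDW) χ z hz
  refine ⟨T, hT, hzT, ?_⟩
  rw [map_zero, ← F.ev_res, F.res_comp, F.res_comp]
  have h1 : F.ev χ (hT.trans le_rfl) (F.res inf_le_left (hT.trans (hW'.trans hDUV)) s) =
      F.ev (F.dual.res _ hT χ) le_rfl (F.res inf_le_left (hT.trans (hW'.trans hDUV)) s) := rfl
  refine h1.trans ?_
  rw [ha, F.sum_ev]
  refine Finset.sum_eq_zero fun j _ => ?_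
  rw [F.smul_ev, F.ev_dual_res]
  have hTD : T ≤ D := hT.trans hW'
  have h2 := congrArg (fun θ : F.dual.sec D (hDUV.trans inf_le_left) =>
    F.ev θ hTD (F.res inf_le_left (hTD.trans hDUV) s)) (hψ j)
  have h3 : F.ev (F.dual.res inf_le_left hDUV (ψ j)) hTD
      (F.res inf_le_left (hTD.trans hDUV) s) = 0 := by
    have h4 := F.ev_res (ψ j) le_rfl (hTD.trans hDUV) s
    rw [hs j, map_zero] at h4
    exact h4
  have h5 := h2.symm.trans h3
  rw [F.smul_ev, F.ev_dual_res, map_pow, rs_rs, rs_rs] at h5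
  have hu : IsUnit (rs X.presheaf (hTD.trans hDV) h ^ k j) :=
    (isUnit_rs_basicOpen h hTD (hTD.trans hDV)).pow _
  have h6 := (hu.mul_right_eq_zero).mp h5
  rw [h6, mul_zero]

lemma pushforward_isFiniteType {X : Scheme.{u}} [IsLocallyNoetherian X] (hX : IsNormalScheme X)
    {U : X.Opens} (hZ : hasEverywhereCodimAtLeastTwo ((U : Set X)ᶜ))
    (F : OModuleOn X.presheaf U) (hF : F.IsReflexive) (hfin : F.IsFiniteType) :
    F.pushforward.IsFiniteType := by
  intro x hx
  have hdual := dual_isFiniteType hX F hfin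
  obtain ⟨V, hxV, -, hV, hd, hN, hI⟩ := exists_good_nbhd hX x ⊤ trivial
  refine ⟨V, le_top, hxV, ?_⟩
  apply generates_of_ext F.pushforward hV le_top
  · intro g D hD hDV hne t
    obtain ⟨k, s', hs'⟩ := ext_reflexive F hF hdual (inf_le_left : U ⊓ V ≤ U)
      (inf_le_inf_left U hDV) (intgOn_mono inf_le_right hI) (inf_ne_bot' hX hZ hne)
      (isCompact_inf hV) (rs X.presheaf (inf_le_right : U ⊓ V ≤ V) g)
      (by
        rw [basicOpen_rs, hD, inf_assoc]
        congr 1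
        exact (inf_eq_right.mpr (X.basicOpen_le g)).symm) t
    refine ⟨k, s', hs'.trans ?_⟩
    have h1 : rs X.presheaf (inf_le_inf_left U hDV) (rs X.presheaf (inf_le_right : U ⊓ V ≤ V) g) ^ k
        = rs X.presheaf (inf_le_right : U ⊓ D ≤ D) (rs X.presheaf hDV g ^ k) := by
      rw [map_pow, rs_rs, rs_rs]
    rw [h1]
    rfl
  · obtain ⟨m, ψ, hψ⟩ := exists_functionals hZ F hF.sep hfin hdual hV hI
    let ρ := rs X.presheaf (inf_le_right : U ⊓ V ≤ V)
    have hinj : Function.Injective ρ := fun a b hab =>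
      hI.eq le_rfl (inf_le_right : U ⊓ V ≤ V) (inf_ne_bot hZ hV) inf_le_right inf_le_right hab
    have hsurj : Function.Surjective ρ := hartogs_scheme hX hZ hV hI
    let e := RingEquiv.ofBijective ρ ⟨hinj, hsurj⟩
    let L : F.pushforward.sec V le_top →ₗ[Γ(X, V)] (Fin m → Γ(X, V)) :=
      { toFun := fun s j => e.symm (F.ev (ψ j) le_rfl s)
        map_add' := fun s t => by
          funext j
          exact (congrArg e.symm (F.ev_add (ψ j) le_rfl s t)).trans (map_add e.symm _ _)
        map_smul' := fun r s => by
          funext j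
          refine (congrArg e.symm (F.ev_smul (ψ j) le_rfl (ρ r) s)).trans ?_
          refine (map_mul e.symm _ _).trans ?_
          exact congrArg₂ (· * ·) (e.symm_apply_apply r) rfl }
    refine Module.Finite.of_injective L ?_
    rw [← LinearMap.ker_eq_bot, LinearMap.ker_eq_bot']
    intro s hs
    refine hψ s fun j => ?_
    have h1 : e.symm (F.ev (ψ j) le_rfl s) = 0 := congrFun hs j
    exact (map_eq_zero_iff e.symm e.symm.injective).mp h1

theorem pushforward_reflexive_coherent_of_reflexive_coherent
    (X : Scheme.{u}) [IsLocallyNoetherian X] (hXnormal : IsNormalScheme X)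
    (R₀ : Type u) [CommRing R₀] (hreg : IsRegularCommRing R₀) (I : Ideal R₀)
    (f : X ⟶ Spec (CommRingCat.of (R₀ ⧸ I))) [LocallyOfFiniteType f]
    (U : X.Opens) (hZ : hasEverywhereCodimAtLeastTwo ((U : Set X)ᶜ))
    (F : OModuleOn X.presheaf U) (hFsheaf : F.IsSheaf)
    (hFrefl : F.IsReflexive) (hFcoh : F.IsCoherent) :
    F.pushforward.IsSheaf ∧ F.pushforward.IsReflexive ∧ F.pushforward.IsCoherent := by
  refine ⟨F.pushforward_isSheaf hFsheaf,
    F.pushforward_isReflexive hFrefl (unit_sep hXnormal hZ),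
    pushforward_isFiniteType hXnormal hZ F hFrefl hFcoh.1, ?_⟩
  intro W hW n s
  exact relations_of_tf hXnormal F.pushforward
    (pushforward_tf hXnormal hZ F hFrefl.sep.tf) W hW n s
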